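/- Every cubic graph G on n vertices contains a spanning subgraph H such that |m(H,k) − n/4| ≤ 3/2 for every 0 ≤ k ≤ 3; moreover the bound 3/2 can be improved to 1/2 unless G is isomorphic to K_4, 3K_4, or K_{3,3}. -/

import Mathlib

open SimpleGraph

/-- The degree of `v` in `H`, as the cardinality of its neighbor set. -/
noncomputable def nDeg {V : Type*} (H : SimpleGraph V) (v : V) : ℕ :=
  (H.neighborSet v).ncard

/-- The number of vertices of degree `k` in `H`. -/
noncomputable def degCount {V : Type*} (H : SimpleGraph V) (k : ℕ) : ℕ :=
  {v | nDeg H v = k}.ncard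

def K4 : SimpleGraph (Fin 4) := completeGraph (Fin 4)

def K33 : SimpleGraph (Fin 3 ⊕ Fin 3) := completeBipartiteGraph (Fin 3) (Fin 3)

/-- The disjoint union of `m` copies of `K₄`. -/
def unionK4 (m : ℕ) : SimpleGraph (Fin m × Fin 4) :=
  SimpleGraph.fromRel (fun p q => p.1 = q.1)

section Counting

variable {V : Type*} [Fintype V] {G H : SimpleGraph V}

open Classical in
theorem nDeg_eq_card (H : SimpleGraph V) (v : V) :
    nDeg H v = (Finset.univ.filter (H.Adj v)).card := by
  rw [nDeg, ← Set.ncard_coe_finset]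
  congr 1
  ext x
  simp

open Classical in
theorem degCount_eq_card (H : SimpleGraph V) (k : ℕ) :
    degCount H k = (Finset.univ.filter (fun v => nDeg H v = k)).card := by
  rw [degCount, ← Set.ncard_coe_finset]
  congr 1
  ext x
  simp

theorem nDeg_mono (h : H ≤ G) (v : V) : nDeg H v ≤ nDeg G v :=
  Set.ncard_le_ncard (fun _ hx => h hx) (Set.toFinite _)

theorem exists_adj_of_nDeg_pos {v : V} (h : 0 < nDeg H v) : ∃ x, H.Adj v x :=
  (Set.ncard_pos (Set.toFinite _)).1 h

theorem exists_adj_ne_of_one_lt_nDeg {V : Type*} {H : SimpleGraph V} {v : V} (h : 1 < nDeg H v)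
    (y : V) :
    ∃ x, H.Adj v x ∧ x ≠ y :=
  Set.exists_ne_of_one_lt_ncard h y

theorem eq_zero_of_nDeg_eq_zero {v x : V} (h : nDeg H v = 0) : ¬ H.Adj v x := by
  intro hx
  have : 0 < nDeg H v := (Set.ncard_pos (Set.toFinite _)).2 ⟨x, hx⟩
  omega

theorem nDeg_sdiff (h : H ≤ G) (v : V) : nDeg (G \ H) v + nDeg H v = nDeg G v := by
  have : (G \ H).neighborSet v = G.neighborSet v \ H.neighborSet v := by
    ext x; simp
  rw [nDeg, this]
  exact Set.ncard_sdiff_add_ncard_of_subset (fun _ hx => h hx) (Set.toFinite _)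

theorem degCount_sdiff (hG : ∀ v, nDeg G v = 3) (h : H ≤ G) {k : ℕ} (hk : k ≤ 3) :
    degCount (G \ H) k = degCount H (3 - k) := by
  rw [degCount, degCount]
  congr 1
  ext v
  have := nDeg_sdiff h v
  have := hG v
  simp only [Set.mem_ofPred_eq]
  omega

theorem even_sum_nDeg (H : SimpleGraph V) : Even (∑ v, nDeg H v) := by
  classical
  have h : ∀ v, nDeg H v = H.degree v := fun v => by
    rw [nDeg_eq_card, ← SimpleGraph.card_neighborFinset_eq_degree]
    congr 1
    ext x
    simp
  simp only [h, H.sum_degrees_eq_twice_card_edges, even_two_mul]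

open Classical in
theorem sum_eq_degCount (hG : ∀ v, nDeg G v = 3) (h : H ≤ G) (f : ℕ → ℕ) :
    ∑ v, f (nDeg H v) = f 0 * degCount H 0 + f 1 * degCount H 1 + f 2 * degCount H 2 +
      f 3 * degCount H 3 := by
  have hm : ∀ v ∈ (Finset.univ : Finset V), nDeg H v ∈ Finset.range 4 := fun v _ => by
    have := nDeg_mono h v
    have := hG v
    simp only [Finset.mem_range]
    omega
  rw [← Finset.sum_fiberwise_of_maps_to hm]
  have : ∀ k ∈ Finset.range 4,
      ∑ v ∈ Finset.univ.filter (fun v => nDeg H v = k), f (nDeg H v) = f k * degCount H k := by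
    intro k _
    rw [degCount_eq_card, Finset.sum_congr rfl (g := fun _ => f k)]
    · simp [mul_comm]
    · intro v hv
      rw [(Finset.mem_filter.1 hv).2]
  rw [Finset.sum_congr rfl this]
  simp [Finset.sum_range_succ]

theorem sum_degCount (hG : ∀ v, nDeg G v = 3) (h : H ≤ G) :
    degCount H 0 + degCount H 1 + degCount H 2 + degCount H 3 = Fintype.card V := by
  have := sum_eq_degCount hG h (fun _ => 1)
  simpa using this.symm

theorem even_degCount_odd (hG : ∀ v, nDeg G v = 3) (h : H ≤ G) :
    Even (degCount H 1 + degCount H 3) := by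
  have h1 := sum_eq_degCount hG h id
  have h2 := even_sum_nDeg H
  simp only [id] at h1
  rw [h1] at h2
  grind

open Classical in
theorem degCount_update {H H' : SimpleGraph V} {u v : V} (huv : u ≠ v)
    (h : ∀ x, x ≠ u → x ≠ v → nDeg H' x = nDeg H x) (k : ℕ) :
    degCount H' k + ((if nDeg H u = k then 1 else 0) + (if nDeg H v = k then 1 else 0)) =
      degCount H k + ((if nDeg H' u = k then 1 else 0) + (if nDeg H' v = k then 1 else 0)) := by
  have key : ∀ K : SimpleGraph V, degCount K k =
      (∑ x ∈ Finset.univ \ {u, v}, if nDeg K x = k then 1 else 0) +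
        ((if nDeg K u = k then 1 else 0) + (if nDeg K v = k then 1 else 0)) := fun K => by
    rw [degCount_eq_card, Finset.card_filter, ← Finset.sum_sdiff (Finset.subset_univ {u, v}),
      Finset.sum_pair huv]
  rw [key H, key H']
  have : (∑ x ∈ Finset.univ \ {u, v}, if nDeg H' x = k then 1 else 0) =
      ∑ x ∈ Finset.univ \ {u, v}, if nDeg H x = k then 1 else 0 := by
    refine Finset.sum_congr rfl fun x hx => ?_
    simp only [Finset.mem_sdiff, Finset.mem_univ, true_and, Finset.mem_insert,
      Finset.mem_singleton, not_or] at hx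
    rw [h x hx.1 hx.2]
  omega

open Classical in
/-- Adding an absent edge whose ends have degrees `i` and `j`. -/
theorem exists_add_edge (hH : H ≤ G) {u v : V} {i j : ℕ} (huv : G.Adj u v) (hn : ¬ H.Adj u v)
    (hu : nDeg H u = i) (hv : nDeg H v = j) :
    ∃ H' ≤ G, (∀ x, x = u ∨ x = v ∨ nDeg H' x = nDeg H x) ∧ nDeg H' u = i + 1 ∧
      nDeg H' v = j + 1 ∧
      (∀ x y, (x = u ∧ y = v) ∨ (x = v ∧ y = u) ∨ (H'.Adj x y ↔ H.Adj x y)) ∧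
      ∀ k, degCount H' k + ((if i = k then 1 else 0) + (if j = k then 1 else 0)) =
        degCount H k + ((if i + 1 = k then 1 else 0) + (if j + 1 = k then 1 else 0)) := by
  have hne := huv.ne
  have hadj : ∀ x y, (H ⊔ edge u v).Adj x y ↔ H.Adj x y ∨ (x = u ∧ y = v ∨ x = v ∧ y = u) := by
    intro x y
    rw [sup_adj, edge_adj]
    grind
  have hdeg : ∀ a b, (a = u ∧ b = v ∨ a = v ∧ b = u) →
      nDeg (H ⊔ edge u v) a = nDeg H a + 1 := by
    intro a b hab
    rw [nDeg, nDeg, ← Set.ncard_insert_of_notMem (a := b)]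
    · congr 1
      ext x
      simp only [mem_neighborSet, hadj, Set.mem_insert_iff]
      grind
    · rw [mem_neighborSet]
      have := H.adj_comm u v
      grind
  have hout : ∀ x, x ≠ u → x ≠ v → nDeg (H ⊔ edge u v) x = nDeg H x := by
    intro x hxu hxv
    rw [nDeg, nDeg]
    congr 1
    ext y
    simp only [mem_neighborSet, hadj]
    grind
  have h1 := hdeg u v (Or.inl ⟨rfl, rfl⟩)
  have h2 := hdeg v u (Or.inr ⟨rfl, rfl⟩)
  refine ⟨H ⊔ edge u v, ?_, by grind, by rw [h1, hu], by rw [h2, hv], ?_, ?_⟩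
  · refine sup_le hH fun x y hxy => ?_
    have := huv.symm
    rw [edge_adj] at hxy
    grind
  · intro x y
    rw [hadj]
    grind
  · intro k
    have := degCount_update hne hout k
    rwa [h1, h2, hu, hv] at this

open Classical in
/-- Removing a present edge whose ends have degrees `i + 1` and `j + 1`. -/
theorem exists_remove_edge (hH : H ≤ G) {u v : V} {i j : ℕ} (huv : H.Adj u v)
    (hu : nDeg H u = i + 1) (hv : nDeg H v = j + 1) :
    ∃ H' ≤ G, (∀ x, x = u ∨ x = v ∨ nDeg H' x = nDeg H x) ∧ nDeg H' u = i ∧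
      nDeg H' v = j ∧
      (∀ x y, (x = u ∧ y = v) ∨ (x = v ∧ y = u) ∨ (H'.Adj x y ↔ H.Adj x y)) ∧
      ∀ k, degCount H' k + ((if i + 1 = k then 1 else 0) + (if j + 1 = k then 1 else 0)) =
        degCount H k + ((if i = k then 1 else 0) + (if j = k then 1 else 0)) := by
  have hne := huv.ne
  have hadj : ∀ x y, (H \ edge u v).Adj x y ↔ H.Adj x y ∧ ¬ (x = u ∧ y = v ∨ x = v ∧ y = u) := by
    intro x y
    rw [sdiff_adj, edge_adj]
    grind
  have hdeg : ∀ a b, (a = u ∧ b = v ∨ a = v ∧ b = u) →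
      nDeg (H \ edge u v) a + 1 = nDeg H a := by
    intro a b hab
    rw [nDeg, nDeg, ← Set.ncard_insert_of_notMem (a := b)]
    · congr 1
      ext x
      simp only [mem_neighborSet, hadj, Set.mem_insert_iff]
      have := H.adj_comm u v
      grind
    · rw [mem_neighborSet, hadj]
      grind
  have hout : ∀ x, x ≠ u → x ≠ v → nDeg (H \ edge u v) x = nDeg H x := by
    intro x hxu hxv
    rw [nDeg, nDeg]
    congr 1
    ext y
    simp only [mem_neighborSet, hadj]
    grind
  have h1 := hdeg u v (Or.inl ⟨rfl, rfl⟩)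
  have h2 := hdeg v u (Or.inr ⟨rfl, rfl⟩)
  have h1' : nDeg (H \ edge u v) u = i := by omega
  have h2' : nDeg (H \ edge u v) v = j := by omega
  refine ⟨H \ edge u v, sdiff_le.trans hH, by grind, h1', h2', ?_, ?_⟩
  · intro x y
    rw [hadj]
    grind
  · intro k
    have := degCount_update hne hout k
    rwa [h1', h2', hu, hv] at this

end Counting

section Moves

variable {V : Type*} [Fintype V] {G H : SimpleGraph V}

/-- Some spanning subgraph of `G` is obtained from `H` by moving one vertex from degree `0` to
degree `1` and one from degree `3` to degree `2`, as far as the degree counts are concerned. -/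
def ShiftsInward (G H : SimpleGraph V) : Prop :=
  ∃ H' ≤ G, degCount H' 0 + 1 = degCount H 0 ∧ degCount H' 1 = degCount H 1 + 1 ∧
    degCount H' 2 = degCount H 2 + 1 ∧ degCount H' 3 + 1 = degCount H 3

theorem shiftsInward_of_sdiff (hG : ∀ v, nDeg G v = 3) (hH : H ≤ G)
    (h : ShiftsInward G (G \ H)) : ShiftsInward G H := by
  obtain ⟨K, hK, h0, h1, h2, h3⟩ := h
  rw [degCount_sdiff hG hH (by norm_num)] at h0 h1 h2 h3
  refine ⟨G \ K, sdiff_le, ?_⟩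
  simp only [degCount_sdiff hG hK (show 0 ≤ 3 by norm_num),
    degCount_sdiff hG hK (show 1 ≤ 3 by norm_num), degCount_sdiff hG hK (show 2 ≤ 3 by norm_num),
    degCount_sdiff hG hK (show 3 ≤ 3 by norm_num)]
  norm_num at *
  omega

theorem shiftsInward_of_edges_zero_zero_one_three (hH : H ≤ G) {x y o t : V} (hxy : G.Adj x y)
    (hx : nDeg H x = 0) (hy : nDeg H y = 0)
    (hot : H.Adj o t) (ho : nDeg H o = 1) (ht : nDeg H t = 3) : ShiftsInward G H := by
  have := hxy.ne
  have := hot.ne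
  have hn : ∀ {a b : V}, nDeg H a = 0 → ¬ H.Adj a b := eq_zero_of_nDeg_eq_zero
  obtain ⟨H₁, h₁, d₁, u₁, v₁, a₁, c₁⟩ := exists_add_edge hH (u := x) (v := y) (i := 0) (j := 0)
    (by assumption) (by grind (splits := 30) [SimpleGraph.adj_comm]) (by grind (splits := 30))
    (by grind (splits := 30))
  obtain ⟨H₂, h₂, d₂, u₂, v₂, a₂, c₂⟩ := exists_remove_edge h₁ (u := o) (v := t) (i := 0) (j := 2)
    (by grind (splits := 30) [SimpleGraph.adj_comm]) (by grind (splits := 30))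
    (by grind (splits := 30))
  refine ⟨H₂, h₂, ?_⟩
  have := c₁ 0; have := c₁ 1; have := c₁ 2; have := c₁ 3
  have := c₂ 0; have := c₂ 1; have := c₂ 2; have := c₂ 3
  simp at *
  omega

theorem shiftsInward_of_edges_zero_one_two_three (hH : H ≤ G) {z o w t : V} (hzo : G.Adj z o)
    (hwt : H.Adj w t) (hz : nDeg H z = 0) (ho : nDeg H o = 1) (hw : nDeg H w = 2)
    (ht : nDeg H t = 3) : ShiftsInward G H := by
  have := hzo.ne
  have := hwt.ne
  have hn : ∀ {a b : V}, nDeg H a = 0 → ¬ H.Adj a b := eq_zero_of_nDeg_eq_zero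
  obtain ⟨H₁, h₁, d₁, u₁, v₁, a₁, c₁⟩ := exists_add_edge hH (u := z) (v := o) (i := 0) (j := 1)
    (by assumption) (by grind (splits := 30) [SimpleGraph.adj_comm]) (by grind (splits := 30))
    (by grind (splits := 30))
  obtain ⟨H₂, h₂, d₂, u₂, v₂, a₂, c₂⟩ := exists_remove_edge h₁ (u := w) (v := t) (i := 1) (j := 2)
    (by grind (splits := 30) [SimpleGraph.adj_comm]) (by grind (splits := 30))
    (by grind (splits := 30))
  refine ⟨H₂, h₂, ?_⟩
  have := c₁ 0; have := c₁ 1; have := c₁ 2; have := c₁ 3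
  have := c₂ 0; have := c₂ 1; have := c₂ 2; have := c₂ 3
  simp at *
  omega

theorem shiftsInward_of_edges_zero_two_three_three (hH : H ≤ G) {z w t t' : V} (hzw : G.Adj z w)
    (htt : H.Adj t t') (hz : nDeg H z = 0) (hw : nDeg H w = 2) (ht : nDeg H t = 3)
    (ht' : nDeg H t' = 3) : ShiftsInward G H := by
  have := hzw.ne
  have := htt.ne
  have hn : ∀ {a b : V}, nDeg H a = 0 → ¬ H.Adj a b := eq_zero_of_nDeg_eq_zero
  obtain ⟨H₁, h₁, d₁, u₁, v₁, a₁, c₁⟩ := exists_add_edge hH (u := z) (v := w) (i := 0) (j := 2)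
    (by assumption) (by grind (splits := 30) [SimpleGraph.adj_comm]) (by grind (splits := 30))
    (by grind (splits := 30))
  obtain ⟨H₂, h₂, d₂, u₂, v₂, a₂, c₂⟩ := exists_remove_edge h₁ (u := t) (v := t') (i := 2) (j := 2)
    (by grind (splits := 30) [SimpleGraph.adj_comm]) (by grind (splits := 30))
    (by grind (splits := 30))
  refine ⟨H₂, h₂, ?_⟩
  have := c₁ 0; have := c₁ 1; have := c₁ 2; have := c₁ 3
  have := c₂ 0; have := c₂ 1; have := c₂ 2; have := c₂ 3
  simp at *
  omega

theorem shiftsInward_of_path_of_path_one_two_three (hH : H ≤ G) {x y z o w t : V}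
    (hxy : G.Adj x y) (hyz : G.Adj y z) (hxz : x ≠ z)
    (hx : nDeg H x = 0) (hy : nDeg H y = 0) (hz : nDeg H z = 0)
    (how : H.Adj w o) (hwt : H.Adj w t) (ho : nDeg H o = 1) (hw : nDeg H w = 2) (ht : nDeg H t = 3)
    : ShiftsInward G H := by
  have := hxy.ne
  have := hyz.ne
  have := how.ne
  have := hwt.ne
  have hn : ∀ {a b : V}, nDeg H a = 0 → ¬ H.Adj a b := eq_zero_of_nDeg_eq_zero
  obtain ⟨H₁, h₁, d₁, u₁, v₁, a₁, c₁⟩ := exists_add_edge hH (u := x) (v := y) (i := 0) (j := 0)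
    (by assumption) (by grind (splits := 30) [SimpleGraph.adj_comm]) (by grind (splits := 30))
    (by grind (splits := 30))
  obtain ⟨H₂, h₂, d₂, u₂, v₂, a₂, c₂⟩ := exists_add_edge h₁ (u := y) (v := z) (i := 1) (j := 0)
    (by assumption) (by grind (splits := 30) [SimpleGraph.adj_comm]) (by grind (splits := 30))
    (by grind (splits := 30))
  obtain ⟨H₃, h₃, d₃, u₃, v₃, a₃, c₃⟩ := exists_remove_edge h₂ (u := w) (v := o) (i := 1) (j := 0)
    (by grind (splits := 30) [SimpleGraph.adj_comm]) (by grind (splits := 30))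
    (by grind (splits := 30))
  obtain ⟨H₄, h₄, d₄, u₄, v₄, a₄, c₄⟩ := exists_remove_edge h₃ (u := w) (v := t) (i := 0) (j := 2)
    (by grind (splits := 30) [SimpleGraph.adj_comm]) (by grind (splits := 30))
    (by grind (splits := 30))
  refine ⟨H₄, h₄, ?_⟩
  have := c₁ 0; have := c₁ 1; have := c₁ 2; have := c₁ 3
  have := c₂ 0; have := c₂ 1; have := c₂ 2; have := c₂ 3
  have := c₃ 0; have := c₃ 1; have := c₃ 2; have := c₃ 3
  have := c₄ 0; have := c₄ 1; have := c₄ 2; have := c₄ 3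
  simp at *
  omega

theorem shiftsInward_of_path_of_edges_one_one_two_three (hH : H ≤ G) {x y z o o' w t : V}
    (hxy : G.Adj x y) (hyz : G.Adj y z) (hxz : x ≠ z)
    (hx : nDeg H x = 0) (hy : nDeg H y = 0) (hz : nDeg H z = 0)
    (hoo : H.Adj o o') (hwt : H.Adj w t) (ho : nDeg H o = 1) (ho' : nDeg H o' = 1)
    (hw : nDeg H w = 2) (ht : nDeg H t = 3) : ShiftsInward G H := by
  have := hxy.ne
  have := hyz.ne
  have := hoo.ne
  have := hwt.ne
  have hn : ∀ {a b : V}, nDeg H a = 0 → ¬ H.Adj a b := eq_zero_of_nDeg_eq_zero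
  obtain ⟨H₁, h₁, d₁, u₁, v₁, a₁, c₁⟩ := exists_add_edge hH (u := x) (v := y) (i := 0) (j := 0)
    (by assumption) (by grind (splits := 30) [SimpleGraph.adj_comm]) (by grind (splits := 30))
    (by grind (splits := 30))
  obtain ⟨H₂, h₂, d₂, u₂, v₂, a₂, c₂⟩ := exists_add_edge h₁ (u := y) (v := z) (i := 1) (j := 0)
    (by assumption) (by grind (splits := 30) [SimpleGraph.adj_comm]) (by grind (splits := 30))
    (by grind (splits := 30))
  obtain ⟨H₃, h₃, d₃, u₃, v₃, a₃, c₃⟩ := exists_remove_edge h₂ (u := o) (v := o') (i := 0) (j := 0)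
    (by grind (splits := 30) [SimpleGraph.adj_comm]) (by grind (splits := 30))
    (by grind (splits := 30))
  obtain ⟨H₄, h₄, d₄, u₄, v₄, a₄, c₄⟩ := exists_remove_edge h₃ (u := w) (v := t) (i := 1) (j := 2)
    (by grind (splits := 30) [SimpleGraph.adj_comm]) (by grind (splits := 30))
    (by grind (splits := 30))
  refine ⟨H₄, h₄, ?_⟩
  have := c₁ 0; have := c₁ 1; have := c₁ 2; have := c₁ 3
  have := c₂ 0; have := c₂ 1; have := c₂ 2; have := c₂ 3
  have := c₃ 0; have := c₃ 1; have := c₃ 2; have := c₃ 3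
  have := c₄ 0; have := c₄ 1; have := c₄ 2; have := c₄ 3
  simp at *
  omega

theorem shiftsInward_of_edges_one_two_two_three_one_one (hH : H ≤ G) {x y o w w' t o₁ o₂ : V}
    (hxy : G.Adj x y)
    (hx : nDeg H x = 0) (hy : nDeg H y = 0)
    (how : H.Adj o w) (hwt : H.Adj w' t) (hoo : G.Adj o₁ o₂) (hnoo : ¬ H.Adj o₁ o₂)
    (ho : nDeg H o = 1) (hw : nDeg H w = 2) (hw' : nDeg H w' = 2) (ht : nDeg H t = 3)
    (ho₁ : nDeg H o₁ = 1) (ho₂ : nDeg H o₂ = 1)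
    (hww : w ≠ w') (ho₁o : o ≠ o₁) (ho₂o : o ≠ o₂) : ShiftsInward G H := by
  have := hxy.ne
  have := how.ne
  have := hwt.ne
  have := hoo.ne
  have hn : ∀ {a b : V}, nDeg H a = 0 → ¬ H.Adj a b := eq_zero_of_nDeg_eq_zero
  obtain ⟨H₁, h₁, d₁, u₁, v₁, a₁, c₁⟩ := exists_add_edge hH (u := x) (v := y) (i := 0) (j := 0)
    (by assumption) (by grind (splits := 30) [SimpleGraph.adj_comm]) (by grind (splits := 30))
    (by grind (splits := 30))
  obtain ⟨H₂, h₂, d₂, u₂, v₂, a₂, c₂⟩ := exists_remove_edge h₁ (u := o) (v := w) (i := 0) (j := 1)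
    (by grind (splits := 30) [SimpleGraph.adj_comm]) (by grind (splits := 30))
    (by grind (splits := 30))
  obtain ⟨H₃, h₃, d₃, u₃, v₃, a₃, c₃⟩ := exists_remove_edge h₂ (u := w') (v := t) (i := 1) (j := 2)
    (by grind (splits := 30) [SimpleGraph.adj_comm]) (by grind (splits := 30))
    (by grind (splits := 30))
  obtain ⟨H₄, h₄, d₄, u₄, v₄, a₄, c₄⟩ := exists_add_edge h₃ (u := o₁) (v := o₂) (i := 1) (j := 1)
    (by assumption) (by grind (splits := 30) [SimpleGraph.adj_comm]) (by grind (splits := 30))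
    (by grind (splits := 30))
  refine ⟨H₄, h₄, ?_⟩
  have := c₁ 0; have := c₁ 1; have := c₁ 2; have := c₁ 3
  have := c₂ 0; have := c₂ 1; have := c₂ 2; have := c₂ 3
  have := c₃ 0; have := c₃ 1; have := c₃ 2; have := c₃ 3
  have := c₄ 0; have := c₄ 1; have := c₄ 2; have := c₄ 3
  simp at *
  omega

theorem shiftsInward_of_edges_one_two_three_three_one_two (hH : H ≤ G) {x y o w t t' o₁ w₁ : V}
    (hxy : G.Adj x y)
    (hx : nDeg H x = 0) (hy : nDeg H y = 0)
    (how : H.Adj o w) (htt : H.Adj t t') (how₁ : G.Adj o₁ w₁) (hnow : ¬ H.Adj o₁ w₁)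
    (ho : nDeg H o = 1) (hw : nDeg H w = 2) (ht : nDeg H t = 3) (ht' : nDeg H t' = 3)
    (ho₁ : nDeg H o₁ = 1) (hw₁ : nDeg H w₁ = 2)
    (ho₁o : o ≠ o₁) (hw₁w : w ≠ w₁) : ShiftsInward G H := by
  have := hxy.ne
  have := how.ne
  have := htt.ne
  have := how₁.ne
  have hn : ∀ {a b : V}, nDeg H a = 0 → ¬ H.Adj a b := eq_zero_of_nDeg_eq_zero
  obtain ⟨H₁, h₁, d₁, u₁, v₁, a₁, c₁⟩ := exists_add_edge hH (u := x) (v := y) (i := 0) (j := 0)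
    (by assumption) (by grind (splits := 30) [SimpleGraph.adj_comm]) (by grind (splits := 30))
    (by grind (splits := 30))
  obtain ⟨H₂, h₂, d₂, u₂, v₂, a₂, c₂⟩ := exists_remove_edge h₁ (u := o) (v := w) (i := 0) (j := 1)
    (by grind (splits := 30) [SimpleGraph.adj_comm]) (by grind (splits := 30))
    (by grind (splits := 30))
  obtain ⟨H₃, h₃, d₃, u₃, v₃, a₃, c₃⟩ := exists_remove_edge h₂ (u := t) (v := t') (i := 2) (j := 2)
    (by grind (splits := 30) [SimpleGraph.adj_comm]) (by grind (splits := 30))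
    (by grind (splits := 30))
  obtain ⟨H₄, h₄, d₄, u₄, v₄, a₄, c₄⟩ := exists_add_edge h₃ (u := o₁) (v := w₁) (i := 1) (j := 2)
    (by assumption) (by grind (splits := 30) [SimpleGraph.adj_comm]) (by grind (splits := 30))
    (by grind (splits := 30))
  refine ⟨H₄, h₄, ?_⟩
  have := c₁ 0; have := c₁ 1; have := c₁ 2; have := c₁ 3
  have := c₂ 0; have := c₂ 1; have := c₂ 2; have := c₂ 3
  have := c₃ 0; have := c₃ 1; have := c₃ 2; have := c₃ 3
  have := c₄ 0; have := c₄ 1; have := c₄ 2; have := c₄ 3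
  simp at *
  omega

theorem shiftsInward_of_switch_one_one (hH : H ≤ G) {x y o w o₁ w' t : V}
    (hxy : G.Adj x y)
    (hx : nDeg H x = 0) (hy : nDeg H y = 0)
    (hwo : H.Adj w o) (hwo₁ : G.Adj w o₁) (hnwo : ¬ H.Adj w o₁) (hwt : H.Adj w' t)
    (ho : nDeg H o = 1) (hw : nDeg H w = 2) (ho₁ : nDeg H o₁ = 1) (hw' : nDeg H w' = 2)
    (ht : nDeg H t = 3)
    (hww : w ≠ w') : ShiftsInward G H := by
  have := hxy.ne
  have := hwo.ne
  have := hwo₁.ne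
  have := hwt.ne
  have hn : ∀ {a b : V}, nDeg H a = 0 → ¬ H.Adj a b := eq_zero_of_nDeg_eq_zero
  obtain ⟨H₁, h₁, d₁, u₁, v₁, a₁, c₁⟩ := exists_add_edge hH (u := x) (v := y) (i := 0) (j := 0)
    (by assumption) (by grind (splits := 30) [SimpleGraph.adj_comm]) (by grind (splits := 30))
    (by grind (splits := 30))
  obtain ⟨H₂, h₂, d₂, u₂, v₂, a₂, c₂⟩ := exists_remove_edge h₁ (u := w) (v := o) (i := 1) (j := 0)
    (by grind (splits := 30) [SimpleGraph.adj_comm]) (by grind (splits := 30))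
    (by grind (splits := 30))
  obtain ⟨H₃, h₃, d₃, u₃, v₃, a₃, c₃⟩ := exists_add_edge h₂ (u := w) (v := o₁) (i := 1) (j := 1)
    (by assumption) (by grind (splits := 30) [SimpleGraph.adj_comm]) (by grind (splits := 30))
    (by grind (splits := 30))
  obtain ⟨H₄, h₄, d₄, u₄, v₄, a₄, c₄⟩ := exists_remove_edge h₃ (u := w') (v := t) (i := 1) (j := 2)
    (by grind (splits := 30) [SimpleGraph.adj_comm]) (by grind (splits := 30))
    (by grind (splits := 30))
  refine ⟨H₄, h₄, ?_⟩
  have := c₁ 0; have := c₁ 1; have := c₁ 2; have := c₁ 3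
  have := c₂ 0; have := c₂ 1; have := c₂ 2; have := c₂ 3
  have := c₃ 0; have := c₃ 1; have := c₃ 2; have := c₃ 3
  have := c₄ 0; have := c₄ 1; have := c₄ 2; have := c₄ 3
  simp at *
  omega

theorem shiftsInward_of_switch_one_two (hH : H ≤ G) {x y v o w t t' : V} {i : ℕ}
    (hxy : G.Adj x y)
    (hx : nDeg H x = 0) (hy : nDeg H y = 0)
    (hvo : H.Adj v o) (hvw : G.Adj v w) (hnvw : ¬ H.Adj v w) (htt : H.Adj t t')
    (hv : nDeg H v = i + 1) (hi : i < 2)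
    (ho : nDeg H o = 1) (hw : nDeg H w = 2) (ht : nDeg H t = 3) (ht' : nDeg H t' = 3)
    : ShiftsInward G H := by
  have := hxy.ne
  have := hvo.ne
  have := hvw.ne
  have := htt.ne
  have hn : ∀ {a b : V}, nDeg H a = 0 → ¬ H.Adj a b := eq_zero_of_nDeg_eq_zero
  obtain ⟨H₁, h₁, d₁, u₁, v₁, a₁, c₁⟩ := exists_add_edge hH (u := x) (v := y) (i := 0) (j := 0)
    (by assumption) (by grind (splits := 30) [SimpleGraph.adj_comm]) (by grind (splits := 30))
    (by grind (splits := 30))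
  obtain ⟨H₂, h₂, d₂, u₂, v₂, a₂, c₂⟩ := exists_remove_edge h₁ (u := v) (v := o) (i := i) (j := 0)
    (by grind (splits := 30) [SimpleGraph.adj_comm]) (by grind (splits := 30))
    (by grind (splits := 30))
  obtain ⟨H₃, h₃, d₃, u₃, v₃, a₃, c₃⟩ := exists_add_edge h₂ (u := v) (v := w) (i := i) (j := 2)
    (by assumption) (by grind (splits := 30) [SimpleGraph.adj_comm]) (by grind (splits := 30))
    (by grind (splits := 30))
  obtain ⟨H₄, h₄, d₄, u₄, v₄, a₄, c₄⟩ := exists_remove_edge h₃ (u := t) (v := t') (i := 2) (j := 2)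
    (by grind (splits := 30) [SimpleGraph.adj_comm]) (by grind (splits := 30))
    (by grind (splits := 30))
  refine ⟨H₄, h₄, ?_⟩
  have := c₁ 0; have := c₁ 1; have := c₁ 2; have := c₁ 3
  have := c₂ 0; have := c₂ 1; have := c₂ 2; have := c₂ 3
  have := c₃ 0; have := c₃ 1; have := c₃ 2; have := c₃ 3
  have := c₄ 0; have := c₄ 1; have := c₄ 2; have := c₄ 3
  simp at *
  omega

theorem shiftsInward_of_paths_of_edges_one_one_two_two (hH : H ≤ G) {x y z t t' t'' o o' w w' : V}
    (hxy : G.Adj x y) (hyz : G.Adj y z) (hxz : x ≠ z)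
    (hx : nDeg H x = 0) (hy : nDeg H y = 0) (hz : nDeg H z = 0)
    (htt : H.Adj t t') (htt' : H.Adj t' t'') (hne : t ≠ t'')
    (hoo : H.Adj o o') (hww : G.Adj w w') (hnww : ¬ H.Adj w w')
    (ht : nDeg H t = 3) (ht' : nDeg H t' = 3) (ht'' : nDeg H t'' = 3)
    (ho : nDeg H o = 1) (ho' : nDeg H o' = 1) (hw : nDeg H w = 2) (hw' : nDeg H w' = 2)
    : ShiftsInward G H := by
  have := hxy.ne
  have := hyz.ne
  have := htt.ne
  have := htt'.ne
  have := hoo.ne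
  have := hww.ne
  have hn : ∀ {a b : V}, nDeg H a = 0 → ¬ H.Adj a b := eq_zero_of_nDeg_eq_zero
  obtain ⟨H₁, h₁, d₁, u₁, v₁, a₁, c₁⟩ := exists_add_edge hH (u := x) (v := y) (i := 0) (j := 0)
    (by assumption) (by grind (splits := 80) [SimpleGraph.adj_comm]) (by grind (splits := 80))
    (by grind (splits := 80))
  obtain ⟨H₂, h₂, d₂, u₂, v₂, a₂, c₂⟩ := exists_add_edge h₁ (u := y) (v := z) (i := 1) (j := 0)
    (by assumption) (by grind (splits := 80) [SimpleGraph.adj_comm]) (by grind (splits := 80))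
    (by grind (splits := 80))
  obtain ⟨H₃, h₃, d₃, u₃, v₃, a₃, c₃⟩ := exists_remove_edge h₂ (u := t) (v := t') (i := 2) (j := 2)
    (by grind (splits := 80) [SimpleGraph.adj_comm]) (by grind (splits := 80))
    (by grind (splits := 80))
  obtain ⟨H₄, h₄, d₄, u₄, v₄, a₄, c₄⟩ := exists_remove_edge h₃ (u := t') (v := t'') (i := 1)
    (j := 2)
    (by grind (splits := 80) [SimpleGraph.adj_comm]) (by grind (splits := 80))
    (by grind (splits := 80))
  obtain ⟨H₅, h₅, d₅, u₅, v₅, a₅, c₅⟩ := exists_remove_edge h₄ (u := o) (v := o') (i := 0) (j := 0)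
    (by grind (splits := 80) [SimpleGraph.adj_comm]) (by grind (splits := 80))
    (by grind (splits := 80))
  obtain ⟨H₆, h₆, d₆, u₆, v₆, a₆, c₆⟩ := exists_add_edge h₅ (u := w) (v := w') (i := 2) (j := 2)
    (by assumption) (by grind (splits := 80) [SimpleGraph.adj_comm]) (by grind (splits := 80))
    (by grind (splits := 80))
  refine ⟨H₆, h₆, ?_⟩
  have := c₁ 0; have := c₁ 1; have := c₁ 2; have := c₁ 3
  have := c₂ 0; have := c₂ 1; have := c₂ 2; have := c₂ 3
  have := c₃ 0; have := c₃ 1; have := c₃ 2; have := c₃ 3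
  have := c₄ 0; have := c₄ 1; have := c₄ 2; have := c₄ 3
  have := c₅ 0; have := c₅ 1; have := c₅ 2; have := c₅ 3
  have := c₆ 0; have := c₆ 1; have := c₆ 2; have := c₆ 3
  simp at *
  omega

end Moves

section Balancing

variable {V : Type*} [Fintype V] {G H : SimpleGraph V}

open Classical in
theorem sum_card_adj_comm {V : Type*} (K : SimpleGraph V) (S T : Finset V) :
    ∑ v ∈ S, (T.filter (K.Adj v)).card = ∑ v ∈ T, (S.filter (K.Adj v)).card := by
  simp only [Finset.card_filter]
  rw [Finset.sum_comm]
  simp only [K.adj_comm]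

theorem exists_adj_zero_zero (hG : ∀ v, nDeg G v = 3) (hH : H ≤ G)
    (h : 2 * degCount H 1 + degCount H 2 < 3 * degCount H 0) :
    ∃ x y, G.Adj x y ∧ nDeg H x = 0 ∧ nDeg H y = 0 := by
  classical
  by_contra! hc
  obtain ⟨K, hK⟩ : ∃ K, K = G \ H := ⟨_, rfl⟩
  set S := Finset.univ.filter (fun v => nDeg H v = 0) with hS
  set T := Finset.univ.filter (fun v => ¬ nDeg H v = 0) with hT
  have h1 : ∑ v ∈ S, (T.filter (K.Adj v)).card = 3 * degCount H 0 := by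
    rw [Finset.sum_congr rfl (g := fun _ => 3), degCount_eq_card, Finset.sum_const, smul_eq_mul,
      mul_comm]
    intro v hv
    have hv' : nDeg H v = 0 := (Finset.mem_filter.1 hv).2
    rw [← hG v, nDeg_eq_card]
    congr 1
    ext x
    have := hc v x
    have := eq_zero_of_nDeg_eq_zero (x := x) hv'
    simp only [hT, Finset.mem_filter, Finset.mem_univ, true_and, hK, sdiff_adj]
    tauto
  have h2 : ∑ v ∈ T, (S.filter (K.Adj v)).card ≤ 2 * degCount H 1 + degCount H 2 := by
    have h3 := sum_eq_degCount hG hH (fun i => if i = 0 then 0 else 3 - i)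
    norm_num at h3
    rw [← h3, Finset.sum_ite, Finset.sum_const_zero, zero_add]
    refine Finset.sum_le_sum fun v _ => ?_
    have := nDeg_sdiff hH v
    rw [hG v, ← hK] at this
    have h4 : (S.filter (K.Adj v)).card ≤ nDeg K v := by
      rw [nDeg_eq_card]
      exact Finset.card_le_card (Finset.filter_subset_filter _ (Finset.subset_univ _))
    omega
  rw [sum_card_adj_comm] at h1
  omega

theorem exists_adj_three_three (hG : ∀ v, nDeg G v = 3) (hH : H ≤ G)
    (h : 2 * degCount H 2 + degCount H 1 < 3 * degCount H 3) :
    ∃ x y, H.Adj x y ∧ nDeg H x = 3 ∧ nDeg H y = 3 := by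
  obtain ⟨x, y, hxy, hx, hy⟩ := exists_adj_zero_zero (H := G \ H) hG sdiff_le (by
    simpa [degCount_sdiff hG hH] using h)
  have h1 := nDeg_sdiff hH x
  have h2 := nDeg_sdiff hH y
  have h3 := eq_zero_of_nDeg_eq_zero (x := y) hx
  rw [sdiff_adj] at h3
  rw [hG] at h1 h2
  exact ⟨x, y, by tauto, by omega, by omega⟩

/-- A spanning subgraph whose degrees are split evenly between `{0, 1}` and `{2, 3}`, with the
extreme degrees attained at least as often as they should, can be modified until it is balanced or
the degree counts are off by one each. -/
theorem exists_balanced_or_off_by_one (hG : ∀ v, nDeg G v = 3) (hH : H ≤ G)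
    (hN : degCount H 0 + degCount H 1 = degCount H 2 + degCount H 3)
    (h0 : (degCount H 0 + degCount H 1) / 2 ≤ degCount H 0)
    (h3 : (degCount H 0 + degCount H 1) / 2 ≤ degCount H 3) :
    ∃ H' ≤ G, (∀ k ≤ 3, Fintype.card V ≤ 4 * degCount H' k + 2 ∧
        4 * degCount H' k ≤ Fintype.card V + 2) ∨
      degCount H' 0 = degCount H' 1 + 2 ∧ degCount H' 2 = degCount H' 1 ∧
        degCount H' 3 = degCount H' 1 + 2 := by
  induction hm : degCount H 0 + degCount H 3 using Nat.strong_induction_on generalizing H with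
  | _ m ih =>
  have hs := sum_degCount hG hH
  have hp := even_degCount_odd hG hH
  rw [Nat.even_iff] at hp
  by_cases hd : degCount H 0 + degCount H 3 = degCount H 0 + degCount H 1
  · refine ⟨H, hH, Or.inl fun k hk => ?_⟩
    interval_cases k <;> omega
  by_cases h0' : (degCount H 0 + degCount H 1) / 2 + 2 ≤ degCount H 0
  · obtain ⟨x, y, hxy, hx, hy⟩ := exists_adj_zero_zero hG hH (by omega)
    obtain ⟨K, hK, -, -, -, -, c⟩ := exists_add_edge hH hxy (eq_zero_of_nDeg_eq_zero hx) hx hy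
    have c0 := c 0; have c1 := c 1; have c2 := c 2; have c3 := c 3
    simp at c0 c1 c2 c3
    exact ih (degCount K 0 + degCount K 3) (by omega) hK (by omega) (by omega) (by omega) rfl
  by_cases h3' : (degCount H 0 + degCount H 1) / 2 + 2 ≤ degCount H 3
  · obtain ⟨x, y, hxy, hx, hy⟩ := exists_adj_three_three hG hH (by omega)
    obtain ⟨K, hK, -, -, -, -, c⟩ := exists_remove_edge hH hxy hx hy
    have c0 := c 0; have c1 := c 1; have c2 := c 2; have c3 := c 3
    simp at c0 c1 c2 c3
    exact ih (degCount K 0 + degCount K 3) (by omega) hK (by omega) (by omega) (by omega) rfl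
  exact ⟨H, hH, Or.inr (by omega)⟩

end Balancing

section Shifting

variable {V : Type*} [Fintype V] {G H : SimpleGraph V}

theorem exists_of_degCount_pos {k : ℕ} (h : 0 < degCount H k) : ∃ v, nDeg H v = k :=
  (Set.ncard_pos (Set.toFinite _)).1 h

theorem exists_ne_of_one_lt_degCount {V : Type*} {H : SimpleGraph V} {k : ℕ}
    (h : 1 < degCount H k) (x : V) : ∃ v, nDeg H v = k ∧ v ≠ x :=
  Set.exists_ne_of_one_lt_ncard h x

theorem one_lt_degCount {k : ℕ} {x y : V} (hx : nDeg H x = k) (hy : nDeg H y = k) (hxy : x ≠ y) :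
    1 < degCount H k :=
  (Set.one_lt_ncard (Set.toFinite _)).2 ⟨x, hx, y, hy, hxy⟩

theorem adj_of_nDeg_eq_three (hG : ∀ v, nDeg G v = 3) (hH : H ≤ G) {t x : V}
    (ht : nDeg H t = 3) (h : G.Adj t x) : H.Adj t x := by
  have h1 := nDeg_sdiff hH t
  rw [hG, ht] at h1
  have h2 := eq_zero_of_nDeg_eq_zero (H := G \ H) (v := t) (x := x) (by omega)
  rw [sdiff_adj] at h2
  tauto

/-- The case in which some edge of `H` joins vertices of degrees `2` and `3`. -/
theorem shiftsInward_of_adj_two_three (hG : ∀ v, nDeg G v = 3) (hH : H ≤ G)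
    (hm : degCount H 2 = degCount H 1) (hm0 : 0 < degCount H 1)
    {x y z w' t t₁ t₂ : V} (hxy : G.Adj x y) (hyz : G.Adj y z) (hxz : x ≠ z)
    (hx : nDeg H x = 0) (hy : nDeg H y = 0) (hz : nDeg H z = 0)
    (hwt : H.Adj w' t) (hw' : nDeg H w' = 2) (ht : nDeg H t = 3)
    (htt : H.Adj t₁ t₂) (ht₁ : nDeg H t₁ = 3) (ht₂ : nDeg H t₂ = 3)
    (hZ : ∀ z x, nDeg H z = 0 → G.Adj z x → nDeg H x = 0)
    (h13 : ∀ o t, nDeg H o = 1 → nDeg H t = 3 → ¬ H.Adj o t) : ShiftsInward G H := by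
  by_contra hS
  have hle : ∀ v, nDeg H v ≤ 3 := fun v => hG v ▸ nDeg_mono hH v
  have hw : ∀ o, nDeg H o = 1 → ∃ w, nDeg H w = 2 ∧ H.Adj o w ∧ w ≠ w' := by
    intro o ho
    obtain ⟨w, how⟩ := exists_adj_of_nDeg_pos (H := H) (v := o) (by omega)
    have h0 : nDeg H w ≠ 0 := fun h => eq_zero_of_nDeg_eq_zero h how.symm
    have h1 : nDeg H w ≠ 1 := fun h =>
      hS (shiftsInward_of_path_of_edges_one_one_two_three hH hxy hyz hxz hx hy hz how hwt
        ho h hw' ht)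
    have h3 : nDeg H w ≠ 3 := fun h => h13 o w ho h how
    have h2 : nDeg H w = 2 := by have := hle w; omega
    refine ⟨w, h2, how, ?_⟩
    rintro rfl
    exact hS (shiftsInward_of_path_of_path_one_two_three hH hxy hyz hxz hx hy hz how.symm hwt
      ho h2 ht)
  have habs : ∀ o x, nDeg H o = 1 → (G \ H).Adj o x → nDeg H x = 1 ∨ nDeg H x = 2 := by
    intro o x ho hox
    rw [sdiff_adj] at hox
    have h0 : nDeg H x ≠ 0 := fun h => by
      have := hZ x o h hox.1.symm
      omega
    have h3 : nDeg H x ≠ 3 := fun h =>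
      hox.2 (adj_of_nDeg_eq_three hG hH h hox.1.symm).symm
    have := hle x
    omega
  obtain ⟨o₁, ho₁⟩ := exists_of_degCount_pos hm0
  obtain ⟨w₀, hw₀, -, hne₀⟩ := hw o₁ ho₁
  have hm1 : 1 < degCount H 1 := hm ▸ one_lt_degCount hw₀ hw' hne₀
  by_cases h : ∃ o₁ x, nDeg H o₁ = 1 ∧ nDeg H x = 2 ∧ (G \ H).Adj o₁ x
  · obtain ⟨o₁, x, ho₁, hx2, hox⟩ := h
    rw [sdiff_adj] at hox
    obtain ⟨o, ho, hoo⟩ := exists_ne_of_one_lt_degCount hm1 o₁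
    obtain ⟨w, hw2, how, hww⟩ := hw o ho
    by_cases hwx : w = x
    · subst hwx
      exact hS (shiftsInward_of_switch_one_one hH hxy hx hy how.symm hox.1.symm
        (fun h => hox.2 h.symm) hwt ho hw2 ho₁ hw' ht hww)
    · exact hS (shiftsInward_of_edges_one_two_three_three_one_two hH hxy hx hy how htt hox.1 hox.2
        ho hw2 ht₁ ht₂ ho₁ hx2 hoo hwx)
  · push Not at h
    have h2 : nDeg (G \ H) o₁ = 2 := by
      have := nDeg_sdiff hH o₁
      rw [hG] at this
      omega
    obtain ⟨o₂, ha₂⟩ := exists_adj_of_nDeg_pos (H := G \ H) (v := o₁) (by omega)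
    obtain ⟨o₃, ha₃, hne⟩ := exists_adj_ne_of_one_lt_nDeg (H := G \ H) (v := o₁) (by omega) o₂
    have ho₂ : nDeg H o₂ = 1 := (habs o₁ o₂ ho₁ ha₂).resolve_right fun h' => h _ _ ho₁ h' ha₂
    have ho₃ : nDeg H o₃ = 1 := (habs o₁ o₃ ho₁ ha₃).resolve_right fun h' => h _ _ ho₁ h' ha₃
    obtain ⟨w, hw2, how, hww⟩ := hw o₃ ho₃
    rw [sdiff_adj] at ha₂
    exact hS (shiftsInward_of_edges_one_two_two_three_one_one hH hxy hx hy how hwt ha₂.1 ha₂.2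
      ho₃ hw2 hw' ht ho₁ ho₂ hww ha₃.ne.symm hne)

end Shifting

section Closed

variable {V : Type*} [Fintype V] {G H : SimpleGraph V}

theorem even_ncard_of_closed (hG : ∀ v, nDeg G v = 3) {S : Set V}
    (hS : ∀ x y, x ∈ S → G.Adj x y → y ∈ S) : Even S.ncard := by
  classical
  let K : SimpleGraph V :=
    { Adj := fun x y => G.Adj x y ∧ x ∈ S
      symm := ⟨fun x y h => ⟨h.1.symm, hS x y h.2 h.1⟩⟩
      loopless := ⟨fun x h => G.loopless.irrefl x h.1⟩ }
  have hK : ∀ v, nDeg K v = if v ∈ S then 3 else 0 := fun v => by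
    split_ifs with hv
    · rw [← hG v, nDeg, nDeg]
      congr 1
      ext x
      exact and_iff_left hv
    · rw [nDeg, Set.ncard_eq_zero]
      ext x
      exact iff_of_false (fun h => hv h.2) id
  have := even_sum_nDeg K
  simp only [hK, ← Finset.sum_filter, Finset.sum_const, smul_eq_mul] at this
  rw [Nat.even_mul] at this
  have h2 : S.ncard = (Finset.univ.filter (· ∈ S)).card := by
    rw [← Set.ncard_coe_finset]
    congr 1
    ext x
    simp
  rw [h2]
  exact this.resolve_right (by decide)

theorem adj_of_closed_of_ncard_eq_four (hG : ∀ v, nDeg G v = 3) {S : Set V}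
    (hS : ∀ x y, x ∈ S → G.Adj x y → y ∈ S) (h4 : S.ncard = 4) {x y : V} (hx : x ∈ S)
    (hy : y ∈ S) (hxy : x ≠ y) : G.Adj x y := by
  have h1 : G.neighborSet x ⊆ S \ {x} := fun z hz => ⟨hS x z hx hz, (G.ne_of_adj hz).symm⟩
  have h2 : (S \ {x}).ncard = 3 := by
    rw [Set.ncard_sdiff_singleton_of_mem hx, h4]
  have h3 := Set.eq_of_subset_of_ncard_le h1 (by rw [h2]; exact (hG x).ge) (Set.toFinite _)
  have : y ∈ G.neighborSet x := h3 ▸ ⟨hy, hxy.symm⟩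
  exact this

theorem nonempty_iso_unionK4 (hG : ∀ v, nDeg G v = 3) {m : ℕ} (c : V → Fin m)
    (hc : ∀ x y, G.Adj x y → c x = c y) (h4 : ∀ i, {v | c v = i}.ncard = 4) :
    Nonempty (G ≃g unionK4 m) := by
  classical
  have hf : ∀ i, Nonempty ({v // c v = i} ≃ Fin 4) := fun i =>
    ⟨Finite.equivFinOfCardEq (h4 i)⟩
  let e : V ≃ Fin m × Fin 4 := (Equiv.sigmaFiberEquiv c).symm.trans
    ((Equiv.sigmaCongrRight fun i => (hf i).some).trans (Equiv.sigmaEquivProd _ _))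
  have he : ∀ v, (e v).1 = c v := fun v => rfl
  refine ⟨⟨e, fun {x y} => ?_⟩⟩
  rw [unionK4, fromRel_adj, he, he, e.injective.ne_iff]
  constructor
  · rintro ⟨hne, h⟩
    have h' : c x = c y := h.elim id Eq.symm
    exact adj_of_closed_of_ncard_eq_four hG (S := {v | c v = c y})
      (fun a b ha hab => (hc a b hab).symm.trans ha) (h4 _) h' rfl hne
  · exact fun h => ⟨h.ne, Or.inl (hc x y h)⟩

theorem exists_ne_not_adj_of_lt_degCount {K : SimpleGraph V} {k : ℕ} {x w : V}
    (h : nDeg K w + 1 < degCount H k) : ∃ v, nDeg H v = k ∧ v ≠ x ∧ ¬ K.Adj w v := by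
  have h1 := Set.ncard_insert_le x (K.neighborSet w)
  obtain ⟨v, hv, hv'⟩ := Set.exists_mem_notMem_of_ncard_lt_ncard (s := insert x (K.neighborSet w))
    (t := {v | nDeg H v = k}) (lt_of_le_of_lt h1 h)
  rw [Set.mem_insert_iff, not_or] at hv'
  exact ⟨v, hv, hv'.1, hv'.2⟩

end Closed

section Shifting

variable {V : Type*} [Fintype V] {G H : SimpleGraph V}

/-- The case in which the vertices of degree `0` and those of degree `3` span unions of components
of `G`. -/
theorem shiftsInward_of_closed (hG : ∀ v, nDeg G v = 3) (hH : H ≤ G)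
    (h0 : degCount H 0 = degCount H 1 + 2) (h2 : degCount H 2 = degCount H 1)
    (h3 : degCount H 3 = degCount H 1 + 2) (hm0 : 0 < degCount H 1)
    (hZ : ∀ z x, nDeg H z = 0 → G.Adj z x → nDeg H x = 0)
    (hT : ∀ t x, nDeg H t = 3 → G.Adj t x → nDeg H x = 3)
    (hiso : ¬ Nonempty (G ≃g unionK4 3)) : ShiftsInward G H := by
  by_contra hS
  have hle : ∀ v, nDeg H v ≤ 3 := fun v => hG v ▸ nDeg_mono hH v
  have hpath : ∀ v, ∃ x y, G.Adj x v ∧ G.Adj v y ∧ x ≠ y := fun v => by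
    obtain ⟨x, hx⟩ := exists_adj_of_nDeg_pos (H := G) (v := v) (by rw [hG]; norm_num)
    obtain ⟨y, hy, hne⟩ :=
      exists_adj_ne_of_one_lt_nDeg (H := G) (v := v) (by rw [hG]; norm_num) x
    exact ⟨x, y, hx.symm, hy, hne.symm⟩
  obtain ⟨y, hy⟩ := exists_of_degCount_pos (H := H) (k := 0) (by omega)
  obtain ⟨x, z, hxy, hyz, hxz⟩ := hpath y
  have hx := hZ y x hy hxy.symm
  have hz := hZ y z hy hyz
  obtain ⟨t', ht'⟩ := exists_of_degCount_pos (H := H) (k := 3) (by omega)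
  obtain ⟨t, t'', htt, htt', hne⟩ := hpath t'
  have ht := hT t' t ht' htt.symm
  have ht'' := hT t' t'' ht' htt'
  replace htt := adj_of_nDeg_eq_three hG hH ht htt
  replace htt' := adj_of_nDeg_eq_three hG hH ht' htt'
  have hmid : ∀ v x, nDeg H v = 1 ∨ nDeg H v = 2 → G.Adj v x → nDeg H x = 1 ∨ nDeg H x = 2 := by
    intro v x hv hvx
    have h0 : nDeg H x ≠ 0 := fun h => by
      have := hZ x v h hvx.symm
      omega
    have h3 : nDeg H x ≠ 3 := fun h => by
      have := hT x v h hvx.symm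
      omega
    have := hle x
    omega
  have hpres : ∀ o, nDeg H o = 1 → ∃ x, H.Adj o x ∧ (nDeg H x = 1 ∨ nDeg H x = 2) := by
    intro o ho
    obtain ⟨x, hox⟩ := exists_adj_of_nDeg_pos (H := H) (v := o) (by omega)
    exact ⟨x, hox, hmid o x (Or.inl ho) (hH hox)⟩
  have habs : ∀ w, nDeg H w = 2 → ∃ x, G.Adj w x ∧ ¬ H.Adj w x ∧
      (nDeg H x = 1 ∨ nDeg H x = 2) := by
    intro w hw
    have := nDeg_sdiff hH w
    rw [hG] at this
    obtain ⟨x, hwx⟩ := exists_adj_of_nDeg_pos (H := G \ H) (v := w) (by omega)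
    rw [sdiff_adj] at hwx
    exact ⟨x, hwx.1, hwx.2, hmid w x (Or.inr hw) hwx.1⟩
  have hswitch : ∀ v o w, nDeg H v = 1 ∨ nDeg H v = 2 → nDeg H o = 1 → nDeg H w = 2 →
      H.Adj v o → G.Adj v w → H.Adj v w := by
    intro v o w hv ho hw hvo hvw
    by_contra hn
    rcases hv with hv | hv
    · exact hS (shiftsInward_of_switch_one_two hH (i := 0) hxy hx hy hvo hvw hn htt hv (by norm_num)
        ho hw ht ht')
    · exact hS (shiftsInward_of_switch_one_two hH (i := 1) hxy hx hy hvo hvw hn htt hv (by norm_num)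
        ho hw ht ht')
  have hdisj : ∀ o w o₁ w₁, nDeg H o = 1 → nDeg H w = 2 → nDeg H o₁ = 1 → nDeg H w₁ = 2 →
      H.Adj o w → G.Adj o₁ w₁ → ¬ H.Adj o₁ w₁ → o ≠ o₁ → w = w₁ := by
    intro o w o₁ w₁ ho hw ho₁ hw₁ how how₁ hn hoo
    by_contra hww
    exact hS (shiftsInward_of_edges_one_two_three_three_one_two hH hxy hx hy how htt how₁ hn
      ho hw ht ht' ho₁ hw₁ hoo hww)
  have hdouble : ∀ o o' w w', nDeg H o = 1 → nDeg H o' = 1 → nDeg H w = 2 → nDeg H w' = 2 →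
      H.Adj o o' → G.Adj w w' → H.Adj w w' := by
    intro o o' w w' ho ho' hw hw' hoo hww
    by_contra hn
    exact hS (shiftsInward_of_paths_of_edges_one_one_two_two hH hxy hyz hxz hx hy hz htt htt' hne
      hoo hww hn ht ht' ht'' ho ho' hw hw')
  have hsmall : 3 < degCount H 1 := by
    have he : Even (degCount H 0) :=
      even_ncard_of_closed hG (S := {v | nDeg H v = 0}) fun a b ha hab => hZ a b ha hab
    rw [Nat.even_iff] at he
    by_contra hlt
    have hM : ∀ v, (nDeg H v = 1 ∨ nDeg H v = 2) ↔ ¬ nDeg H v = 0 ∧ ¬ nDeg H v = 3 := fun v => by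
      have := hle v
      omega
    refine hiso (nonempty_iso_unionK4 hG
      (fun v => if nDeg H v = 0 then 0 else if nDeg H v = 3 then 2 else 1) ?_ ?_)
    · intro a b hab
      have := hZ a b
      have := hZ b a
      have := hT a b
      have := hT b a
      grind [SimpleGraph.adj_comm]
    · have hd : degCount H 1 + degCount H 2 = {v | nDeg H v = 1 ∨ nDeg H v = 2}.ncard := by
        rw [degCount, degCount, ← Set.ncard_union_eq]
        · rfl
        · rw [Set.disjoint_left]
          intro v hv hv'
          simp only [Set.mem_ofPred_eq] at hv hv'
          omega
      intro i
      fin_cases i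
      · trans degCount H 0
        · rw [degCount]
          congr 1
          ext v
          simp only [Set.mem_ofPred_eq]
          grind
        · omega
      · trans degCount H 1 + degCount H 2
        · rw [hd]
          congr 1
          ext v
          simp only [Set.mem_ofPred_eq, hM]
          grind
        · omega
      · trans degCount H 3
        · rw [degCount]
          congr 1
          ext v
          simp only [Set.mem_ofPred_eq]
          grind
        · omega
  by_cases hp12 : ∃ o w, nDeg H o = 1 ∧ nDeg H w = 2 ∧ H.Adj o w
  swap
  · push Not at hp12
    have hp : ∀ o, nDeg H o = 1 → ∃ o', H.Adj o o' ∧ nDeg H o' = 1 := fun o ho => by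
      obtain ⟨o', hoo, ho'⟩ := hpres o ho
      exact ⟨o', hoo, ho'.resolve_right fun h => hp12 o o' ho h hoo⟩
    obtain ⟨o, ho⟩ := exists_of_degCount_pos hm0
    obtain ⟨o', hoo, ho'⟩ := hp o ho
    obtain ⟨w, hw⟩ := exists_of_degCount_pos (h2 ▸ hm0)
    obtain ⟨o₁, hwo, hn, ho₁⟩ := habs w hw
    replace ho₁ := ho₁.resolve_right fun h => hn (hdouble o o' w o₁ ho ho' hw h hoo hwo)
    obtain ⟨o₂, hoo', ho₂⟩ := hp o₁ ho₁
    exact hn (hswitch o₁ o₂ w (Or.inl ho₁) ho₂ hw hoo' hwo.symm).symm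
  obtain ⟨o, w, ho, hw, how⟩ := hp12
  by_cases ha12 : ∃ o₁ w₁, nDeg H o₁ = 1 ∧ nDeg H w₁ = 2 ∧ G.Adj o₁ w₁ ∧ ¬ H.Adj o₁ w₁
  swap
  · push Not at ha12
    obtain ⟨w', hww, hn, hw'⟩ := habs w hw
    refine hn (hswitch w o w' (Or.inr hw) ho (hw'.resolve_left fun h => ?_) how.symm hww)
    exact hn (ha12 w' w h hw hww.symm).symm
  obtain ⟨o₁, w₁, ho₁, hw₁, how₁, hn₁⟩ := ha12
  obtain ⟨o₂, ho₂, hoo₂, hn₂⟩ := exists_ne_not_adj_of_lt_degCount (H := H) (K := H) (k := 1)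
    (x := o₁) (w := w₁) (by omega)
  obtain ⟨o₃, hoo₃, ho₃⟩ := hpres o₂ ho₂
  replace ho₃ := ho₃.resolve_right fun h => hn₂ <| by
    rw [← hdisj o₂ o₃ o₁ w₁ ho₂ h ho₁ hw₁ hoo₃ how₁ hn₁ hoo₂]
    exact hoo₃.symm
  obtain ⟨w₂, hw₂, hww₂, hn₃⟩ := exists_ne_not_adj_of_lt_degCount (H := H) (K := G \ H) (k := 2)
    (x := w) (w := o) (by have := nDeg_sdiff hH o; rw [hG] at this; omega)
  obtain ⟨o₄, hwo₄, hn₄, ho₄⟩ := habs w₂ hw₂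
  replace ho₄ := ho₄.resolve_right fun h => hn₄ (hdouble o₂ o₃ w₂ o₄ ho₂ ho₃ hw₂ h hoo₃ hwo₄)
  have hoo₄ : o ≠ o₄ := by
    rintro rfl
    exact hn₃ (by rw [sdiff_adj]; exact ⟨hwo₄.symm, fun h => hn₄ h.symm⟩)
  exact hww₂ (hdisj o w o₄ w₂ ho hw ho₄ hw₂ how hwo₄.symm (fun h => hn₄ h.symm) hoo₄).symm

theorem shiftsInward_of_not_adj_zero_one (hG : ∀ v, nDeg G v = 3) (hH : H ≤ G)
    (h0 : degCount H 0 = degCount H 1 + 2) (h2 : degCount H 2 = degCount H 1)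
    (h3 : degCount H 3 = degCount H 1 + 2) (hm0 : 0 < degCount H 1)
    (h01 : ∀ z o, nDeg H z = 0 → nDeg H o = 1 → ¬ G.Adj z o)
    (hiso : ¬ Nonempty (G ≃g unionK4 3)) : ShiftsInward G H := by
  by_contra hS
  have hle : ∀ v, nDeg H v ≤ 3 := fun v => hG v ▸ nDeg_mono hH v
  obtain ⟨x, y, hxy, hx, hy⟩ := exists_adj_zero_zero hG hH (by omega)
  obtain ⟨t₁, t₂, htt, ht₁, ht₂⟩ := exists_adj_three_three hG hH (by omega)
  have h13 : ∀ o t, nDeg H o = 1 → nDeg H t = 3 → ¬ H.Adj o t := fun o t ho ht hot =>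
    hS (shiftsInward_of_edges_zero_zero_one_three hH hxy hx hy hot ho ht)
  have hZ : ∀ z x, nDeg H z = 0 → G.Adj z x → nDeg H x = 0 := by
    intro z v hz hzv
    have h1 : nDeg H v ≠ 1 := fun h => h01 z v hz h hzv
    have h2 : nDeg H v ≠ 2 := fun h =>
      hS (shiftsInward_of_edges_zero_two_three_three hH hzv htt hz h ht₁ ht₂)
    have h3 : nDeg H v ≠ 3 := fun h =>
      eq_zero_of_nDeg_eq_zero hz (adj_of_nDeg_eq_three hG hH h hzv.symm).symm
    have := hle v
    omega
  by_cases h23 : ∃ w t, H.Adj w t ∧ nDeg H w = 2 ∧ nDeg H t = 3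
  · obtain ⟨w, t, hwt, hw, ht⟩ := h23
    obtain ⟨z, hyz, hne⟩ := exists_adj_ne_of_one_lt_nDeg (H := G) (v := y) (by rw [hG]; norm_num) x
    exact hS (shiftsInward_of_adj_two_three hG hH h2 hm0 hxy hyz hne.symm hx hy (hZ y z hy hyz)
      hwt hw ht htt ht₁ ht₂ hZ h13)
  · refine hS (shiftsInward_of_closed hG hH h0 h2 h3 hm0 hZ ?_ hiso)
    intro t v ht htv
    have htv' := adj_of_nDeg_eq_three hG hH ht htv
    have h0 : nDeg H v ≠ 0 := fun h => eq_zero_of_nDeg_eq_zero h htv'.symm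
    have h1 : nDeg H v ≠ 1 := fun h => h13 v t h ht htv'.symm
    have h2 : nDeg H v ≠ 2 := fun h => h23 ⟨v, t, htv'.symm, h, ht⟩
    have := hle v
    omega

theorem shiftsInward_of_off_by_one (hG : ∀ v, nDeg G v = 3) (hH : H ≤ G)
    (h0 : degCount H 0 = degCount H 1 + 2) (h2 : degCount H 2 = degCount H 1)
    (h3 : degCount H 3 = degCount H 1 + 2) (hm0 : 0 < degCount H 1)
    (hiso : ¬ Nonempty (G ≃g unionK4 3)) : ShiftsInward G H := by
  by_cases h01 : ∃ z o, nDeg H z = 0 ∧ nDeg H o = 1 ∧ G.Adj z o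
  · obtain ⟨z, o, hz, ho, hzo⟩ := h01
    by_contra hS
    have hd : ∀ v, nDeg (G \ H) v + nDeg H v = 3 := fun v => hG v ▸ nDeg_sdiff hH v
    refine hS (shiftsInward_of_sdiff hG hH (shiftsInward_of_not_adj_zero_one hG sdiff_le
      ?_ ?_ ?_ ?_ ?_ hiso))
    any_goals simp only [degCount_sdiff hG hH (show 0 ≤ 3 by norm_num),
      degCount_sdiff hG hH (show 1 ≤ 3 by norm_num), degCount_sdiff hG hH (show 2 ≤ 3 by norm_num),
      degCount_sdiff hG hH (show 3 ≤ 3 by norm_num)]; norm_num; omega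
    intro t w ht hw htw
    have ht' : nDeg H t = 3 := by have := hd t; omega
    have hw' : nDeg H w = 2 := by have := hd w; omega
    exact hS (shiftsInward_of_edges_zero_one_two_three hH hzo
      (adj_of_nDeg_eq_three hG hH ht' htw).symm hz ho hw' ht')
  · push Not at h01
    exact shiftsInward_of_not_adj_zero_one hG hH h0 h2 h3 hm0 h01 hiso

end Shifting

section Crossing

variable {V : Type*} [Fintype V] {G : SimpleGraph V}

/-- The subgraph of the edges of `G` between `A` and its complement. -/
def crossing (G : SimpleGraph V) (A : Finset V) : SimpleGraph V where
  Adj x y := G.Adj x y ∧ (x ∈ A ↔ y ∉ A)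
  symm := ⟨fun x y h => ⟨h.1.symm, by have := h.2; tauto⟩⟩
  loopless := ⟨fun x h => G.loopless.irrefl x h.1⟩

theorem crossing_le {V : Type*} (G : SimpleGraph V) (A : Finset V) : crossing G A ≤ G :=
  fun _ _ h => h.1

open Classical in
theorem crossing_compl (G : SimpleGraph V) (A : Finset V) : crossing G Aᶜ = crossing G A := by
  ext x y
  simp only [crossing, Finset.mem_compl]
  tauto

open Classical in
/-- The number of neighbors of `x` in `A` minus the number of neighbors outside of `A`. -/
noncomputable def imbalance (G : SimpleGraph V) (A : Finset V) (x : V) : ℤ :=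
  ∑ y, if G.Adj x y then (if y ∈ A then 1 else -1) else 0

open Classical in
theorem mul_imbalance (hG : ∀ v, nDeg G v = 3) (A : Finset V) (x : V) :
    (if x ∈ A then 1 else -1) * imbalance G A x = 3 - 2 * (nDeg (crossing G A) x : ℤ) := by
  have h3 : (3 : ℤ) = ∑ y, if G.Adj x y then 1 else 0 := by
    rw [← Finset.sum_filter, Finset.sum_const, ← nDeg_eq_card, hG]
    norm_num
  have hc : (nDeg (crossing G A) x : ℤ) = ∑ y, if (crossing G A).Adj x y then 1 else 0 := by
    rw [← Finset.sum_filter, Finset.sum_const, ← nDeg_eq_card]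
    norm_num
  rw [h3, hc, imbalance, Finset.mul_sum, Finset.mul_sum, ← Finset.sum_sub_distrib]
  refine Finset.sum_congr rfl fun y _ => ?_
  simp only [crossing]
  by_cases h1 : G.Adj x y <;> by_cases h2 : x ∈ A <;> by_cases h3 : y ∈ A <;> simp [h1, h2, h3]

open Classical in
theorem imbalance_swap (G : SimpleGraph V) {A : Finset V} {a b : V} (ha : a ∈ A) (hb : b ∉ A)
    (x : V) : imbalance G (insert b (A.erase a)) x =
      imbalance G A x + 2 * (if G.Adj x b then 1 else 0) - 2 * (if G.Adj x a then 1 else 0) := by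
  have h : ∀ z, (if G.Adj x z then (1 : ℤ) else 0) =
      ∑ y, if y = z then (if G.Adj x y then 1 else 0) else 0 := fun z => by
    rw [Finset.sum_ite_eq']
    simp
  rw [h a, h b, imbalance, imbalance, Finset.mul_sum, Finset.mul_sum, ← Finset.sum_add_distrib,
    ← Finset.sum_sub_distrib]
  refine Finset.sum_congr rfl fun y _ => ?_
  have : a ≠ b := fun h => hb (h ▸ ha)
  by_cases hya : y = a
  · subst hya
    by_cases h : G.Adj x y <;> simp [h, ha, this]
  · by_cases hyb : y = b
    · subst hyb
      by_cases h : G.Adj x y <;> simp [h, hb, this.symm]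
    · simp [hya, hyb]

open Classical in
theorem sum_nDeg_crossing_swap (hG : ∀ v, nDeg G v = 3) {A : Finset V} {a b : V} (ha : a ∈ A)
    (hb : b ∉ A) : ∑ v, nDeg (crossing G (insert b (A.erase a))) v +
      (4 * nDeg (crossing G A) a + 4 * nDeg (crossing G A) b) =
      ∑ v, nDeg (crossing G A) v + (12 + 4 * if G.Adj a b then 1 else 0) := by
  have hab : a ≠ b := fun h => hb (h ▸ ha)
  set A' := insert b (A.erase a) with hA'
  have key : ∀ B : Finset V, ∑ v, (if v ∈ B then 1 else -1) * imbalance G B v =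
      3 * (Fintype.card V : ℤ) - 2 * ∑ v, (nDeg (crossing G B) v : ℤ) := fun B => by
    simp only [mul_imbalance hG, Finset.sum_sub_distrib, ← Finset.mul_sum, Finset.sum_const,
      Finset.card_univ]
    ring
  have hsign : ∀ v, (if v ∈ A' then (1 : ℤ) else -1) = (if v ∈ A then 1 else -1) +
      2 * (if v = b then 1 else 0) - 2 * (if v = a then 1 else 0) := fun v => by
    by_cases hva : v = a
    · subst hva
      simp [hA', ha, hab]
    · by_cases hvb : v = b
      · subst hvb
        simp [hA', hb, hva]
      · simp [hA', hva, hvb]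
  have himb : ∀ z, ∑ v, (if v ∈ A then (1 : ℤ) else -1) * (if G.Adj v z then 1 else 0) =
      imbalance G A z := fun z => by
    rw [imbalance]
    refine Finset.sum_congr rfl fun y _ => ?_
    simp [G.adj_comm]
  have hswap : ∀ v, imbalance G A' v = _ := imbalance_swap G ha hb
  have h1 := key A
  have h2 := key A'
  have h3 := mul_imbalance hG A a
  have h4 := mul_imbalance hG A b
  have h5 := himb a
  have h6 := himb b
  simp only [ha, hb, if_true, if_false] at h3 h4
  have h7 : ∑ v, (if v ∈ A' then 1 else -1) * imbalance G A' v =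
      ∑ v, (if v ∈ A then 1 else -1) * imbalance G A v + 4 * imbalance G A b -
        4 * imbalance G A a - 8 * (if G.Adj a b then 1 else 0) := by
    simp only [hsign, hswap, add_mul, sub_mul, mul_add, mul_sub,
      Finset.sum_add_distrib, Finset.sum_sub_distrib]
    simp only [mul_left_comm _ (2 : ℤ), mul_assoc, ← Finset.mul_sum, h5, h6]
    simp only [ite_mul, one_mul, zero_mul, Finset.sum_ite_eq', Finset.mem_univ, if_true,
      SimpleGraph.irrefl, if_false, G.adj_comm b a]
    ring
  zify
  linarith

open Classical in
theorem nDeg_crossing_swap (hG : ∀ v, nDeg G v = 3) {A : Finset V} {a b x : V} (ha : a ∈ A)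
    (hb : b ∉ A) (hxa : x ≠ a) (hxb : x ≠ b) :
    (nDeg (crossing G (insert b (A.erase a))) x : ℤ) = nDeg (crossing G A) x +
      (if x ∈ A then 1 else -1) * ((if G.Adj x a then 1 else 0) - if G.Adj x b then 1 else 0) := by
  have h1 := mul_imbalance hG A x
  have h2 := mul_imbalance hG (insert b (A.erase a)) x
  rw [imbalance_swap G ha hb] at h2
  simp only [Finset.mem_insert, Finset.mem_erase, hxa, hxb, false_or, ne_eq, not_false_eq_true,
    true_and] at h2
  by_cases hx : x ∈ A
  · simp only [hx, if_true] at h1 h2 ⊢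
    linarith
  · simp only [hx, if_false] at h1 h2 ⊢
    linarith

/-- A set containing half of the vertices with as few crossing edges as possible. -/
def IsMinBisection (G : SimpleGraph V) (A : Finset V) : Prop :=
  2 * A.card = Fintype.card V ∧ ∀ B : Finset V, 2 * B.card = Fintype.card V →
    ∑ v, nDeg (crossing G A) v ≤ ∑ v, nDeg (crossing G B) v

theorem even_card (hG : ∀ v, nDeg G v = 3) : Even (Fintype.card V) := by
  have := even_sum_nDeg G
  simp only [hG, Finset.sum_const, smul_eq_mul, Nat.even_mul, Finset.card_univ] at this
  exact this.resolve_right (by decide)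

theorem exists_isMinBisection (hG : ∀ v, nDeg G v = 3) : ∃ A, IsMinBisection G A := by
  obtain ⟨N, hN⟩ := even_card hG
  obtain ⟨A₀, -, hA₀⟩ := Finset.exists_subset_card_eq (s := (Finset.univ : Finset V)) (n := N)
    (by rw [Finset.card_univ]; omega)
  obtain ⟨A, hA, hmin⟩ := Set.exists_min_image {A : Finset V | 2 * A.card = Fintype.card V}
    (fun A => ∑ v, nDeg (crossing G A) v) (Set.toFinite _)
    ⟨A₀, show 2 * A₀.card = Fintype.card V by omega⟩
  exact ⟨A, hA, hmin⟩

open Classical in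
theorem IsMinBisection.compl {A : Finset V} (h : IsMinBisection G A) : IsMinBisection G Aᶜ := by
  refine ⟨?_, by rw [crossing_compl]; exact h.2⟩
  have := h.1
  rw [Finset.card_compl]
  omega

open Classical in
theorem card_swap {V : Type*} {A : Finset V} {a b : V} (ha : a ∈ A) (hb : b ∉ A) :
    (insert b (A.erase a)).card = A.card := by
  rw [Finset.card_insert_of_notMem (fun h => hb (Finset.mem_of_mem_erase h)),
    Finset.card_erase_add_one ha]

open Classical in
theorem IsMinBisection.add_le (hG : ∀ v, nDeg G v = 3) {A : Finset V} (h : IsMinBisection G A)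
    {a b : V} (ha : a ∈ A) (hb : b ∉ A) :
    nDeg (crossing G A) a + nDeg (crossing G A) b ≤ 3 + if G.Adj a b then 1 else 0 := by
  have h1 := h.2 (insert b (A.erase a)) (by rw [card_swap ha hb, h.1])
  have h2 := sum_nDeg_crossing_swap hG ha hb
  omega

open Classical in
theorem IsMinBisection.swap (hG : ∀ v, nDeg G v = 3) {A : Finset V} (h : IsMinBisection G A)
    {a b : V} (ha : a ∈ A) (hb : b ∉ A)
    (hab : 3 ≤ nDeg (crossing G A) a + nDeg (crossing G A) b) (hn : ¬ G.Adj a b) :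
    IsMinBisection G (insert b (A.erase a)) := by
  refine ⟨by rw [card_swap ha hb, h.1], fun B hB => le_trans ?_ (h.2 B hB)⟩
  have h2 := sum_nDeg_crossing_swap hG ha hb
  rw [if_neg hn] at h2
  omega

open Classical in
theorem card_filter_add_card_filter_compl (K : SimpleGraph V) (A : Finset V) (v : V) :
    (A.filter (K.Adj v)).card + (Aᶜ.filter (K.Adj v)).card = nDeg K v := by
  rw [nDeg_eq_card, ← Finset.card_union_of_disjoint
    (Finset.disjoint_filter_filter disjoint_compl_right), ← Finset.filter_union,
    Finset.union_compl]

open Classical in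
theorem nDeg_crossing_of_mem {A : Finset V} {v : V} (hv : v ∈ A) :
    nDeg (crossing G A) v = (Aᶜ.filter (G.Adj v)).card := by
  rw [nDeg_eq_card]
  congr 1
  ext x
  simp only [crossing, hv, Finset.mem_filter, Finset.mem_univ, Finset.mem_compl, true_and,
    true_iff]
  tauto

open Classical in
theorem sum_nDeg_crossing_compl (A : Finset V) :
    ∑ v ∈ Aᶜ, nDeg (crossing G A) v = ∑ v ∈ A, nDeg (crossing G A) v := by
  rw [Finset.sum_congr rfl fun v hv => nDeg_crossing_of_mem hv, sum_card_adj_comm]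
  refine Finset.sum_congr rfl fun v hv => ?_
  rw [← crossing_compl, nDeg_crossing_of_mem hv, compl_compl]

open Classical in
theorem even_card_add_sum_nDeg_crossing (hG : ∀ v, nDeg G v = 3) (A : Finset V) :
    Even (A.card + ∑ v ∈ A, nDeg (crossing G A) v) := by
  have h1 : Even (∑ v ∈ A, (A.filter (G.Adj v)).card) := by
    let K : SimpleGraph V :=
      { Adj := fun x y => G.Adj x y ∧ x ∈ A ∧ y ∈ A
        symm := ⟨fun x y h => ⟨h.1.symm, h.2.2, h.2.1⟩⟩
        loopless := ⟨fun x h => G.loopless.irrefl x h.1⟩ }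
    have hK : ∀ v, nDeg K v = if v ∈ A then (A.filter (G.Adj v)).card else 0 := fun v => by
      rw [nDeg_eq_card]
      split_ifs with hv
      · congr 1
        ext x
        simp only [K, hv, Finset.mem_filter, Finset.mem_univ]
        tauto
      · simp [K, hv]
    have := even_sum_nDeg K
    simpa only [hK, Finset.sum_ite_mem, Finset.univ_inter] using this
  have h2 : ∑ v ∈ A, (A.filter (G.Adj v)).card + ∑ v ∈ A, nDeg (crossing G A) v = 3 * A.card := by
    rw [← Finset.sum_add_distrib, Finset.sum_congr rfl (g := fun _ => 3), Finset.sum_const,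
      smul_eq_mul, mul_comm]
    intro v hv
    rw [nDeg_crossing_of_mem hv, card_filter_add_card_filter_compl, hG]
  rw [Nat.even_iff] at *
  omega

end Crossing

section Start

variable {V : Type*} [Fintype V] {G : SimpleGraph V}

open Classical in
/-- Keeping the edges outside of `A` together with one crossing edge at every vertex of `S`. -/
theorem exists_subgraph_of_crossing (hG : ∀ v, nDeg G v = 3) {A S : Finset V} (hSA : S ⊆ A)
    (hA : 2 * A.card = Fintype.card V) (f : V → V) (hf : ∀ a ∈ S, (crossing G A).Adj a (f a))
    (hB : ∀ b, b ∉ A → nDeg (crossing G A) b ≤ 1 ∨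
      nDeg (crossing G A) b = 2 ∧ ∃ a ∈ S, f a = b) :
    ∃ H ≤ G, degCount H 0 + S.card = A.card ∧ degCount H 1 = S.card ∧
      degCount H 2 + degCount H 3 = A.card ∧
      degCount H 3 + ∑ v ∈ A, nDeg (crossing G A) v = A.card + S.card := by
  have hfA : ∀ a ∈ S, f a ∉ A := fun a ha h => by
    have := (hf a ha).2
    have := hSA ha
    tauto
  obtain ⟨H, hadj⟩ : ∃ H : SimpleGraph V, ∀ x y, H.Adj x y ↔
      G.Adj x y ∧ (x ∉ A ∧ y ∉ A ∨ x ∈ S ∧ f x = y ∨ y ∈ S ∧ f y = x) :=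
    ⟨{ Adj := fun x y => G.Adj x y ∧ (x ∉ A ∧ y ∉ A ∨ x ∈ S ∧ f x = y ∨ y ∈ S ∧ f y = x)
       symm := ⟨fun x y h => ⟨h.1.symm, by have := h.2; tauto⟩⟩
       loopless := ⟨fun x h => G.loopless.irrefl x h.1⟩ }, fun _ _ => Iff.rfl⟩
  have hH : H ≤ G := fun x y h => ((hadj x y).1 h).1
  have hAA : ∀ a ∈ A, (A.filter (H.Adj a)).card = 0 := fun a ha => by
    rw [Finset.card_eq_zero, Finset.filter_eq_empty_iff]
    intro x hx hx'
    obtain ⟨-, h | ⟨h, rfl⟩ | ⟨h, rfl⟩⟩ := (hadj _ _).1 hx'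
    · exact h.1 ha
    · exact hfA _ h hx
    · exact hfA _ h ha
  have hAB : ∀ a ∈ A, (Aᶜ.filter (H.Adj a)).card = if a ∈ S then 1 else 0 := fun a ha => by
    split_ifs with hS
    · rw [Finset.card_eq_one]
      refine ⟨f a, ?_⟩
      ext x
      simp only [Finset.mem_filter, Finset.mem_compl, Finset.mem_singleton, hadj]
      constructor
      · rintro ⟨hx, -, h | ⟨-, h⟩ | ⟨h, -⟩⟩
        · exact absurd ha h.1
        · exact h.symm
        · exact absurd (hSA h) hx
      · rintro rfl
        exact ⟨hfA a hS, (hf a hS).1, Or.inr (Or.inl ⟨hS, rfl⟩)⟩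
    · rw [Finset.card_eq_zero, Finset.filter_eq_empty_iff]
      intro x hx hx'
      obtain ⟨-, h | ⟨h, rfl⟩ | ⟨h, rfl⟩⟩ := (hadj _ _).1 hx'
      · exact h.1 ha
      · exact hS h
      · exact Finset.mem_compl.1 hx (hSA h)
  have hBB : ∀ b ∈ Aᶜ, (Aᶜ.filter (H.Adj b)).card + nDeg (crossing G A) b = 3 := fun b hb => by
    rw [← crossing_compl, nDeg_crossing_of_mem hb, compl_compl, ← hG b,
      ← card_filter_add_card_filter_compl G A b, add_comm]
    congr 2
    ext x
    simp only [Finset.mem_filter, hadj, and_congr_right_iff, and_iff_left_iff_imp]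
    exact fun hx _ => Or.inl ⟨Finset.mem_compl.1 hb, Finset.mem_compl.1 hx⟩
  have hdA : ∀ a ∈ A, nDeg H a = if a ∈ S then 1 else 0 := fun a ha => by
    rw [← card_filter_add_card_filter_compl H A a, hAA a ha, hAB a ha, zero_add]
  have hdB : ∀ b ∈ Aᶜ, 2 ≤ nDeg H b := fun b hb => by
    have h1 := hBB b hb
    have h2 := card_filter_add_card_filter_compl H A b
    rcases hB b (Finset.mem_compl.1 hb) with h | ⟨h, a, ha, rfl⟩
    · omega
    · have : 0 < (A.filter (H.Adj (f a))).card :=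
        Finset.card_pos.2 ⟨a, Finset.mem_filter.2 ⟨hSA ha,
          (hadj _ _).2 ⟨(hf a ha).1.symm, Or.inr (Or.inr ⟨ha, rfl⟩)⟩⟩⟩
      omega
  have hm1 : degCount H 1 = S.card := by
    rw [degCount_eq_card]
    congr 1
    ext v
    simp only [Finset.mem_filter, Finset.mem_univ, true_and]
    by_cases hv : v ∈ A
    · rw [hdA v hv]
      simp
    · have := hdB v (Finset.mem_compl.2 hv)
      exact iff_of_false (by omega) fun h => hv (hSA h)
  have hm0 : degCount H 0 = (A \ S).card := by
    rw [degCount_eq_card]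
    congr 1
    ext v
    simp only [Finset.mem_filter, Finset.mem_univ, true_and, Finset.mem_sdiff]
    by_cases hv : v ∈ A
    · rw [hdA v hv]
      simp [hv]
    · have := hdB v (Finset.mem_compl.2 hv)
      exact iff_of_false (by omega) fun h => hv h.1
  have hs := sum_degCount hG hH
  have h1 := Finset.card_sdiff_add_card_eq_card hSA
  refine ⟨H, hH, by omega, hm1, by omega, ?_⟩
  have h2 := sum_eq_degCount hG hH id
  have h3 : ∑ a ∈ A, (Aᶜ.filter (H.Adj a)).card = S.card := by
    rw [Finset.sum_congr rfl hAB, Finset.sum_ite_mem, Finset.inter_eq_right.2 hSA]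
    simp
  have h4 : ∑ a ∈ A, nDeg H a = S.card := by
    rw [Finset.sum_congr rfl hdA, Finset.sum_ite_mem, Finset.inter_eq_right.2 hSA]
    simp
  have h5 : ∑ b ∈ Aᶜ, nDeg H b = S.card + ∑ b ∈ Aᶜ, (Aᶜ.filter (H.Adj b)).card := by
    rw [← h3, sum_card_adj_comm, ← Finset.sum_add_distrib]
    exact Finset.sum_congr rfl fun b _ => (card_filter_add_card_filter_compl H A b).symm
  have h6 : ∑ b ∈ Aᶜ, (Aᶜ.filter (H.Adj b)).card + ∑ b ∈ Aᶜ, nDeg (crossing G A) b =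
      3 * Aᶜ.card := by
    rw [← Finset.sum_add_distrib, Finset.sum_congr rfl hBB, Finset.sum_const, smul_eq_mul, mul_comm]
  rw [sum_nDeg_crossing_compl] at h6
  simp only [id] at h2
  rw [← Finset.sum_add_sum_compl A, h4, h5] at h2
  have h7 := Finset.card_add_card_compl A
  omega

end Start

section Bisection

variable {V : Type*} [Fintype V] {G : SimpleGraph V}

open Classical in
theorem IsMinBisection.adj_of_two_le (hG : ∀ v, nDeg G v = 3) {A : Finset V}
    (h : IsMinBisection G A) {a b : V} (ha : a ∈ A) (hb : b ∉ A)
    (ha2 : 2 ≤ nDeg (crossing G A) a) (hb2 : 2 ≤ nDeg (crossing G A) b) :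
    (crossing G A).Adj a b ∧ nDeg (crossing G A) a = 2 ∧ nDeg (crossing G A) b = 2 := by
  have h1 := h.add_le hG ha hb
  split_ifs at h1 with hab
  · exact ⟨⟨hab, iff_of_true ha hb⟩, by omega, by omega⟩
  · omega

open Classical in
/-- All vertices of `A` with at least two crossing edges are adjacent to any such vertex
outside of `A`. -/
theorem IsMinBisection.card_filter_le (hG : ∀ v, nDeg G v = 3) {A : Finset V}
    (h : IsMinBisection G A) {b : V} (hb : b ∉ A) (hb2 : 2 ≤ nDeg (crossing G A) b) :
    (A.filter (fun a => 2 ≤ nDeg (crossing G A) a)).card ≤ 2 := by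
  rcases (A.filter (fun a => 2 ≤ nDeg (crossing G A) a)).eq_empty_or_nonempty with h0 | ⟨a, ha⟩
  · simp [h0]
  · rw [Finset.mem_filter] at ha
    refine le_trans ?_ (h.adj_of_two_le hG ha.1 hb ha.2 hb2).2.2.le
    rw [nDeg_eq_card _ b]
    refine Finset.card_le_card fun x hx => ?_
    rw [Finset.mem_filter] at hx
    exact Finset.mem_filter.2
      ⟨Finset.mem_univ _, (h.adj_of_two_le hG hx.1 hb hx.2 hb2).1.symm⟩

open Classical in
theorem IsMinBisection.exists_pair (hG : ∀ v, nDeg G v = 3) {A : Finset V}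
    (h : IsMinBisection G A) (hc : A.card < ∑ v ∈ A, nDeg (crossing G A) v) :
    ∃ a₁ ∈ A, ∃ a₂ ∈ A, a₁ ≠ a₂ ∧ 2 ≤ nDeg (crossing G A) a₁ ∧ 2 ≤ nDeg (crossing G A) a₂ ∧
      ∀ v ∈ A, v = a₁ ∨ v = a₂ ∨ nDeg (crossing G A) v = 1 := by
  have hone : ∀ B : Finset V, B.card < ∑ v ∈ B, nDeg (crossing G A) v →
      ∃ v ∈ B, 2 ≤ nDeg (crossing G A) v := fun B hB => by
    by_contra! h'
    refine hB.not_ge ((Finset.sum_le_card_nsmul B _ 1 fun v hv => ?_).trans_eq (mul_one _))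
    exact Nat.lt_succ_iff.1 (h' v hv)
  obtain ⟨b, hb, hb2⟩ := hone Aᶜ (by
    rw [sum_nDeg_crossing_compl, Finset.card_compl]
    have := h.1
    omega)
  rw [Finset.mem_compl] at hb
  obtain ⟨a, ha, ha2⟩ := hone A hc
  have hcb := (h.adj_of_two_le hG ha hb ha2 hb2).2.2
  obtain ⟨T, hT⟩ : ∃ T, T = A.filter (fun a => 2 ≤ nDeg (crossing G A) a) := ⟨_, rfl⟩
  have hT2 := h.card_filter_le hG hb hb2
  rw [← hT] at hT2
  have hle : ∀ v ∈ A, nDeg (crossing G A) v ≤ 1 + if v ∈ T then 1 else 0 := fun v hv => by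
    split_ifs with hvT
    · rw [hT, Finset.mem_filter] at hvT
      exact (h.adj_of_two_le hG hv hb hvT.2 hb2).2.1.le
    · rw [hT, Finset.mem_filter, not_and] at hvT
      have := hvT hv
      omega
  have hsum : ∑ v ∈ A, (1 + if v ∈ T then 1 else 0) = A.card + T.card := by
    rw [Finset.sum_add_distrib, Finset.sum_ite_mem, Finset.inter_eq_right.2
      (hT ▸ Finset.filter_subset _ _)]
    simp
  have hs := Finset.sum_le_sum hle
  have hpar := even_card_add_sum_nDeg_crossing hG A
  rw [Nat.even_iff] at hpar
  have heq := (Finset.sum_eq_sum_iff_of_le hle).1 (by omega)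
  obtain ⟨a₁, a₂, hne, hTe⟩ := Finset.card_eq_two.1 (show T.card = 2 by omega)
  have h1 : a₁ ∈ T := by simp [hTe]
  have h2 : a₂ ∈ T := by simp [hTe]
  have h1' := Finset.mem_filter.1 (hT ▸ h1)
  have h2' := Finset.mem_filter.1 (hT ▸ h2)
  refine ⟨a₁, h1'.1, a₂, h2'.1, hne, h1'.2, h2'.2, fun v hv => ?_⟩
  by_cases hvT : v ∈ T
  · rw [hTe, Finset.mem_insert, Finset.mem_singleton] at hvT
    tauto
  · have := heq v hv
    rw [if_neg hvT] at this
    exact Or.inr (Or.inr this)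

theorem eq_or_eq_of_nDeg_eq_two {K : SimpleGraph V} {v x y z : V} (h : nDeg K v = 2)
    (hx : K.Adj v x) (hy : K.Adj v y) (hxy : x ≠ y) (hz : K.Adj v z) : z = x ∨ z = y := by
  have h1 : ({x, y} : Set V) ⊆ K.neighborSet v := by
    rintro w (rfl | rfl) <;> assumption
  have h2 := Set.eq_of_subset_of_ncard_le h1
    (by rw [Set.ncard_pair hxy]; exact h.le) (Set.toFinite _)
  have : z ∈ ({x, y} : Set V) := h2 ▸ hz
  exact this

open Classical in
theorem IsMinBisection.sum_le_or_exists (hG : ∀ v, nDeg G v = 3) {A : Finset V}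
    (h : IsMinBisection G A) : ∑ v ∈ A, nDeg (crossing G A) v ≤ A.card ∨
    ∃ a₁ ∈ A, ∃ a₂ ∈ A, ∃ b₁ ∉ A, ∃ b₂ ∉ A, a₁ ≠ a₂ ∧ b₁ ≠ b₂ ∧
      (nDeg (crossing G A) a₁ = 2 ∧ nDeg (crossing G A) a₂ = 2 ∧
        nDeg (crossing G A) b₁ = 2 ∧ nDeg (crossing G A) b₂ = 2) ∧
      (∀ v, v = a₁ ∨ v = a₂ ∨ v = b₁ ∨ v = b₂ ∨ nDeg (crossing G A) v = 1) ∧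
      (∀ z, (crossing G A).Adj a₁ z ↔ z = b₁ ∨ z = b₂) ∧
      (∀ z, (crossing G A).Adj a₂ z ↔ z = b₁ ∨ z = b₂) ∧
      (∀ z, (crossing G A).Adj b₁ z ↔ z = a₁ ∨ z = a₂) ∧
      (∀ z, (crossing G A).Adj b₂ z ↔ z = a₁ ∨ z = a₂) := by
  refine or_iff_not_imp_left.2 fun hc => ?_
  rw [not_le] at hc
  obtain ⟨a₁, ha₁, a₂, ha₂, hane, hca₁, hca₂, hA⟩ := h.exists_pair hG hc
  have hcard : Aᶜ.card = A.card := by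
    rw [Finset.card_compl]
    have := h.1
    omega
  have hex := h.compl.exists_pair hG
    (by rw [crossing_compl, hcard, sum_nDeg_crossing_compl]; exact hc)
  simp only [crossing_compl, Finset.mem_compl] at hex
  obtain ⟨b₁, hb₁, b₂, hb₂, hbne, hcb₁, hcb₂, hB⟩ := hex
  obtain ⟨h11, ea₁, eb₁⟩ := h.adj_of_two_le hG ha₁ hb₁ hca₁ hcb₁
  obtain ⟨h22, ea₂, eb₂⟩ := h.adj_of_two_le hG ha₂ hb₂ hca₂ hcb₂
  obtain ⟨h12, -, -⟩ := h.adj_of_two_le hG ha₁ hb₂ hca₁ hcb₂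
  obtain ⟨h21, -, -⟩ := h.adj_of_two_le hG ha₂ hb₁ hca₂ hcb₁
  have key : ∀ {v x y : V}, nDeg (crossing G A) v = 2 → (crossing G A).Adj v x →
      (crossing G A).Adj v y → x ≠ y → ∀ z, (crossing G A).Adj v z ↔ z = x ∨ z = y :=
    fun hv hx hy hxy z =>
      ⟨eq_or_eq_of_nDeg_eq_two hv hx hy hxy, by rintro (rfl | rfl) <;> assumption⟩
  refine ⟨a₁, ha₁, a₂, ha₂, b₁, hb₁, b₂, hb₂, hane, hbne, ⟨ea₁, ea₂, eb₁, eb₂⟩, fun v => ?_,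
    key ea₁ h11 h12 hbne, key ea₂ h21 h22 hbne, key eb₁ h11.symm h21.symm hane,
    key eb₂ h12.symm h22.symm hane⟩
  by_cases hv : v ∈ A
  · have := hA v hv
    tauto
  · have := hB v hv
    tauto

open Classical in
theorem card_filter_compl_add_nDeg_crossing (hG : ∀ v, nDeg G v = 3) {A : Finset V} {b : V}
    (hb : b ∉ A) : (Aᶜ.filter (G.Adj b)).card + nDeg (crossing G A) b = 3 := by
  rw [← crossing_compl, nDeg_crossing_of_mem (Finset.mem_compl.2 hb), compl_compl, ← hG b,
    ← card_filter_add_card_filter_compl G A b, add_comm]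

open Classical in
theorem IsMinBisection.sum_le (hG : ∀ v, nDeg G v = 3) {A : Finset V} (h : IsMinBisection G A)
    (h4 : 4 ≤ A.card) : ∑ v ∈ A, nDeg (crossing G A) v ≤ A.card := by
  refine (h.sum_le_or_exists hG).resolve_right ?_
  rintro ⟨a₁, ha₁, a₂, ha₂, b₁, hb₁, b₂, hb₂, hane, hbne, ⟨ca₁, ca₂, cb₁, cb₂⟩, hone, hna₁, hna₂,
    hnb₁, hnb₂⟩
  have hcard : Aᶜ.card = A.card := by
    rw [Finset.card_compl]
    have := h.1
    omega
  have hnot : ∀ {v w}, v ∉ A → w ∈ A → ¬ (crossing G A).Adj w v → ¬ G.Adj w v :=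
    fun hv hw hn hadj => hn ⟨hadj, iff_of_true hw hv⟩
  obtain ⟨b, hb, hb'⟩ := Finset.exists_mem_notMem_of_card_lt_card
    (s := insert b₁ (insert b₂ (Aᶜ.filter (G.Adj b₁)))) (t := Aᶜ) (by
      have h1 := card_filter_compl_add_nDeg_crossing hG hb₁
      have h2 := Finset.card_insert_le b₁ (insert b₂ (Aᶜ.filter (G.Adj b₁)))
      have h3 := Finset.card_insert_le b₂ (Aᶜ.filter (G.Adj b₁))
      omega)
  simp only [Finset.mem_insert, Finset.mem_filter, hb, true_and, not_or] at hb'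
  obtain ⟨hbb₁, hbb₂, hnb⟩ := hb'
  rw [Finset.mem_compl] at hb
  have hcb : nDeg (crossing G A) b = 1 := by
    have := hone b
    have : b ≠ a₁ := fun e => hb (e ▸ ha₁)
    have : b ≠ a₂ := fun e => hb (e ▸ ha₂)
    tauto
  have hA' := h.swap hG ha₁ hb (by omega) (hnot hb ha₁ (by rw [hna₁]; tauto))
  obtain ⟨z, hz, hz'⟩ := Finset.exists_mem_notMem_of_card_lt_card
    (s := {b₂}) (t := Aᶜ.filter (G.Adj b)) (by
      have h1 := card_filter_compl_add_nDeg_crossing hG hb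
      rw [Finset.card_singleton]
      omega)
  rw [Finset.mem_filter, Finset.mem_compl] at hz
  rw [Finset.mem_singleton] at hz'
  obtain ⟨hzA, hbz⟩ := hz
  have hzb₁ : z ≠ b₁ := by
    rintro rfl
    exact hnb hbz.symm
  have hza : ∀ {a}, a ∈ A → z ≠ a := fun ha e => hzA (e ▸ ha)
  have hcz : nDeg (crossing G A) z = 1 := by
    have := hone z
    have := hza ha₁
    have := hza ha₂
    tauto
  have hna₁z := hnot hzA ha₁ (by rw [hna₁]; tauto)
  have hna₂z := hnot hzA ha₂ (by rw [hna₂]; tauto)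
  have hna₂b := hnot hb ha₂ (by rw [hna₂]; tauto)
  have e1 := nDeg_crossing_swap hG ha₁ hb (hza ha₁) hbz.ne.symm
  have e2 := nDeg_crossing_swap hG ha₁ hb hane.symm (fun e => hb (e ▸ ha₂))
  have e3 := hA'.add_le hG (a := a₂) (b := z)
    (Finset.mem_insert_of_mem (Finset.mem_erase.2 ⟨hane.symm, ha₂⟩))
    (by simp [hbz.ne.symm, hzA])
  rw [if_neg hzA, if_neg (fun e => hna₁z e.symm), if_pos hbz.symm] at e1
  rw [if_pos ha₂, if_neg hna₂b] at e2
  rw [if_neg hna₂z] at e3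
  split_ifs at e2 <;> omega

/-- A cubic graph containing the complete bipartite graph `K₃,₃` as a spanning subgraph. -/
theorem nonempty_iso_K33 (hG : ∀ v, nDeg G v = 3) {S : Set V} (h3 : S.ncard = 3)
    (h3' : Sᶜ.ncard = 3) (hS : ∀ x ∈ S, ∀ y ∉ S, G.Adj x y) : Nonempty (G ≃g K33) := by
  classical
  have hadj : ∀ x ∈ S, ∀ y, G.Adj x y ↔ y ∉ S := fun x hx y => by
    have := Set.eq_of_subset_of_ncard_le (s := Sᶜ) (t := G.neighborSet x) (fun y hy => hS x hx y hy)
      (by rw [h3']; exact (hG x).le) (Set.toFinite _)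
    exact (Set.ext_iff.1 this y).symm
  have hadj' : ∀ x ∉ S, ∀ y, G.Adj x y ↔ y ∈ S := fun x hx y => by
    have := Set.eq_of_subset_of_ncard_le (s := S) (t := G.neighborSet x)
      (fun y hy => (hS y hy x hx).symm) (by rw [h3]; exact (hG x).le) (Set.toFinite _)
    exact (Set.ext_iff.1 this y).symm
  let e₁ : {x // x ∈ S} ≃ Fin 3 := Finite.equivFinOfCardEq h3
  let e₂ : {x // x ∉ S} ≃ Fin 3 := Finite.equivFinOfCardEq h3'
  refine ⟨⟨(Equiv.sumCompl (· ∈ S)).symm.trans (Equiv.sumCongr e₁ e₂), ?_⟩⟩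
  intro x y
  by_cases hx : x ∈ S <;> by_cases hy : y ∈ S
  · simp [K33, Equiv.sumCompl_symm_apply_of_pos, hx, hy, hadj]
  · simp [K33, Equiv.sumCompl_symm_apply_of_pos, Equiv.sumCompl_symm_apply_of_neg, hx, hy, hadj]
  · simp [K33, Equiv.sumCompl_symm_apply_of_pos, Equiv.sumCompl_symm_apply_of_neg, hx, hy, hadj']
  · simp [K33, Equiv.sumCompl_symm_apply_of_neg, hx, hy, hadj']

theorem nonempty_iso_K4 (hG : ∀ v, nDeg G v = 3) (h4 : Fintype.card V = 4) :
    Nonempty (G ≃g K4) := by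
  refine ⟨⟨Fintype.equivFinOfCardEq h4, ?_⟩⟩
  intro x y
  simp only [K4, top_adj, ne_eq, EmbeddingLike.apply_eq_iff_eq]
  exact ⟨fun h => adj_of_closed_of_ncard_eq_four hG (S := Set.univ) (fun _ _ _ _ => trivial)
    (by rw [Set.ncard_univ, Nat.card_eq_fintype_card, h4]) trivial trivial h, fun h => h.ne⟩

open Classical in
theorem IsMinBisection.sum_le_of_card_eq_three (hG : ∀ v, nDeg G v = 3) {A : Finset V}
    (h : IsMinBisection G A) (h3 : A.card = 3) (hiso : ¬ Nonempty (G ≃g K33)) :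
    ∑ v ∈ A, nDeg (crossing G A) v ≤ A.card := by
  refine (h.sum_le_or_exists hG).resolve_right ?_
  rintro ⟨a₁, ha₁, a₂, ha₂, b₁, hb₁, b₂, hb₂, hane, hbne, ⟨ca₁, ca₂, cb₁, cb₂⟩, hone, hna₁, hna₂,
    hnb₁, hnb₂⟩
  have hcard : Aᶜ.card = 3 := by
    rw [Finset.card_compl]
    have := h.1
    omega
  obtain ⟨a, ha, haa⟩ := Finset.exists_mem_notMem_of_card_lt_card (s := {a₁, a₂}) (t := A)
    (by rw [Finset.card_pair hane]; omega)
  obtain ⟨b, hb, hbb⟩ := Finset.exists_mem_notMem_of_card_lt_card (s := {b₁, b₂}) (t := Aᶜ)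
    (by rw [Finset.card_pair hbne]; omega)
  simp only [Finset.mem_insert, Finset.mem_singleton, not_or] at haa hbb
  rw [Finset.mem_compl] at hb
  have hAe : A = {a₁, a₂, a} := (Finset.eq_of_subset_of_card_le (by
    simp only [Finset.insert_subset_iff, Finset.singleton_subset_iff]
    exact ⟨ha₁, ha₂, ha⟩) (by
      rw [h3, Finset.card_eq_three.2 ⟨a₁, a₂, a, hane, Ne.symm haa.1, Ne.symm haa.2, rfl⟩])).symm
  have hBe : Aᶜ = {b₁, b₂, b} := (Finset.eq_of_subset_of_card_le (by
    simp only [Finset.insert_subset_iff, Finset.singleton_subset_iff, Finset.mem_compl]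
    exact ⟨hb₁, hb₂, hb⟩) (by
      rw [hcard, Finset.card_eq_three.2 ⟨b₁, b₂, b, hbne, Ne.symm hbb.1, Ne.symm hbb.2, rfl⟩])).symm
  have hca : nDeg (crossing G A) a = 1 := by grind
  have hcb : nDeg (crossing G A) b = 1 := by grind
  have hfa : A.filter (G.Adj a) = {a₁, a₂} := Finset.eq_of_subset_of_card_le
    (fun x hx => by have := (Finset.mem_filter.1 hx).2.ne; grind) (by
      have := card_filter_compl_add_nDeg_crossing hG (A := Aᶜ) (b := a) (by simpa using ha)
      rw [crossing_compl, compl_compl] at this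
      rw [Finset.card_pair hane]
      omega)
  have hfb : Aᶜ.filter (G.Adj b) = {b₁, b₂} := Finset.eq_of_subset_of_card_le
    (fun x hx => by have := (Finset.mem_filter.1 hx).2.ne; grind) (by
      have := card_filter_compl_add_nDeg_crossing hG hb
      rw [Finset.card_pair hbne]
      omega)
  have hab : G.Adj a b := by
    obtain ⟨y, hy⟩ := exists_adj_of_nDeg_pos (H := crossing G A) (v := a) (by omega)
    have hyA : y ∈ Aᶜ := Finset.mem_compl.2 (hy.2.1 ha)
    have h1 := hnb₁ a
    have h2 := hnb₂ a
    have h3 := hy.symm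
    rw [hBe] at hyA
    simp only [Finset.mem_insert, Finset.mem_singleton] at hyA
    rcases hyA with rfl | rfl | rfl
    · tauto
    · tauto
    · exact hy.1
  have hab' : ∀ {x y}, x ∈ A → y ∉ A → x ≠ y := fun hx hy e => hy (e ▸ hx)
  have hS3 : ({a₁, a₂, b} : Set V).ncard = 3 :=
    Set.ncard_eq_three.2 ⟨a₁, a₂, b, hane, hab' ha₁ hb, hab' ha₂ hb, rfl⟩
  refine hiso (nonempty_iso_K33 hG hS3 ?_ ?_)
  · have h1 := Set.ncard_add_ncard_compl ({a₁, a₂, b} : Set V)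
    rw [Nat.card_eq_fintype_card, ← h.1] at h1
    omega
  · intro x hx y hy
    simp only [Set.mem_insert_iff, Set.mem_singleton_iff, not_or] at hx hy
    have hy' : y = a ∨ y = b₁ ∨ y = b₂ := by
      by_cases hyA : y ∈ A
      · rw [hAe] at hyA
        simp only [Finset.mem_insert, Finset.mem_singleton] at hyA
        tauto
      · rw [← Finset.mem_compl, hBe] at hyA
        simp only [Finset.mem_insert, Finset.mem_singleton] at hyA
        tauto
    have haa₁ : G.Adj a a₁ := (Finset.mem_filter.1 (hfa ▸ Finset.mem_insert_self a₁ {a₂})).2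
    have haa₂ : G.Adj a a₂ :=
      (Finset.mem_filter.1 (hfa ▸ Finset.mem_insert_of_mem (Finset.mem_singleton_self a₂))).2
    have hbb₁ : G.Adj b b₁ := (Finset.mem_filter.1 (hfb ▸ Finset.mem_insert_self b₁ {b₂})).2
    have hbb₂ : G.Adj b b₂ :=
      (Finset.mem_filter.1 (hfb ▸ Finset.mem_insert_of_mem (Finset.mem_singleton_self b₂))).2
    rcases hx with rfl | rfl | rfl <;> rcases hy' with rfl | rfl | rfl
    · exact haa₁.symm
    · exact ((hna₁ _).2 (Or.inl rfl)).1
    · exact ((hna₁ _).2 (Or.inr rfl)).1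
    · exact haa₂.symm
    · exact ((hna₂ _).2 (Or.inl rfl)).1
    · exact ((hna₂ _).2 (Or.inr rfl)).1
    · exact hab.symm
    · exact hbb₁
    · exact hbb₂

end Bisection

section Assembly

variable {V : Type*} [Fintype V] {G : SimpleGraph V}

open Classical in
theorem IsMinBisection.exists_balanced_or_off_by_one (hG : ∀ v, nDeg G v = 3) {A : Finset V}
    (h : IsMinBisection G A) (h3 : 3 ≤ A.card) (hc : ∑ v ∈ A, nDeg (crossing G A) v ≤ A.card)
    (hle : (Aᶜ.filter (fun b => 2 ≤ nDeg (crossing G A) b)).card ≤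
      (A.filter (fun a => 2 ≤ nDeg (crossing G A) a)).card) :
    ∃ H ≤ G, (∀ k ≤ 3, Fintype.card V ≤ 4 * degCount H k + 2 ∧
        4 * degCount H k ≤ Fintype.card V + 2) ∨
      (degCount H 0 = degCount H 1 + 2 ∧ degCount H 2 = degCount H 1 ∧
        degCount H 3 = degCount H 1 + 2) := by
  obtain ⟨T, hT⟩ : ∃ T, T = A.filter (fun a => 2 ≤ nDeg (crossing G A) a) := ⟨_, rfl⟩
  obtain ⟨U, hU⟩ : ∃ U, U = Aᶜ.filter (fun b => 2 ≤ nDeg (crossing G A) b) := ⟨_, rfl⟩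
  obtain ⟨P, hP⟩ : ∃ P, P = A.filter (fun a => 1 ≤ nDeg (crossing G A) a) := ⟨_, rfl⟩
  rw [← hT, ← hU] at hle
  have memT : ∀ v, v ∈ T ↔ v ∈ A ∧ 2 ≤ nDeg (crossing G A) v := fun v => by
    rw [hT, Finset.mem_filter]
  have memU : ∀ v, v ∈ U ↔ v ∉ A ∧ 2 ≤ nDeg (crossing G A) v := fun v => by
    rw [hU, Finset.mem_filter, Finset.mem_compl]
  have memP : ∀ v, v ∈ P ↔ v ∈ A ∧ 1 ≤ nDeg (crossing G A) v := fun v => by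
    rw [hP, Finset.mem_filter]
  have hTP : T ⊆ P := fun v hv =>
    (memP v).2 ⟨((memT v).1 hv).1, Nat.le_of_succ_le ((memT v).1 hv).2⟩
  have hPA : P ⊆ A := fun v hv => ((memP v).1 hv).1
  have hU2 : U.card ≤ 2 := by
    rcases U.eq_empty_or_nonempty with h0 | ⟨b, hb⟩
    · simp [h0]
    · have := h.card_filter_le hG ((memU b).1 hb).1 ((memU b).1 hb).2
      rw [← hT] at this
      omega
  have hsum : ∑ v ∈ A, nDeg (crossing G A) v ≤ P.card + (A.card - A.card / 2) := by
    by_cases h2 : ∀ a ∈ A, nDeg (crossing G A) a ≤ 2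
    · have : ∑ v ∈ A, nDeg (crossing G A) v ≤ ∑ v ∈ A, if v ∈ P then 2 else 0 := by
        refine Finset.sum_le_sum fun v hv => ?_
        have := h2 v hv
        have := memP v
        split_ifs <;> grind
      rw [Finset.sum_ite_mem, Finset.inter_eq_right.2 hPA, Finset.sum_const, smul_eq_mul] at this
      omega
    · push Not at h2
      obtain ⟨a, ha, ha2⟩ := h2
      have hP1 : 0 < P.card := Finset.card_pos.2 ⟨a, (memP a).2 ⟨ha, by omega⟩⟩
      have ha3 : nDeg (crossing G A) a ≤ 3 := (nDeg_mono (crossing_le G A) a).trans (hG a).le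
      have : ∑ v ∈ A, nDeg (crossing G A) v ≤ nDeg (crossing G A) a := by
        rw [← sum_nDeg_crossing_compl, nDeg_crossing_of_mem ha, Finset.card_filter]
        refine Finset.sum_le_sum fun b hb => ?_
        have := h.add_le hG ha (Finset.mem_compl.1 hb)
        omega
      omega
  obtain ⟨e⟩ := Function.Embedding.nonempty_of_card_le (α := U) (β := T) (by simpa using hle)
  have hUP : Finset.univ.image (fun b : U => (e b : V)) ⊆ P := fun v hv => by
    obtain ⟨b, -, rfl⟩ := Finset.mem_image.1 hv
    exact hTP (e b).2
  have hUc : (Finset.univ.image (fun b : U => (e b : V))).card = U.card := by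
    rw [Finset.card_image_of_injective _ fun x y hxy => e.injective (Subtype.ext hxy)]
    simp
  obtain ⟨S, hUS, hSP, hS⟩ := Finset.exists_subsuperset_card_eq hUP
    (n := max U.card (∑ v ∈ A, nDeg (crossing G A) v - (A.card - A.card / 2)))
    (by rw [hUc]; exact le_max_left _ _)
    (by have := Finset.card_le_card hTP; omega)
  have hf : ∀ a, ∃ y, a ∈ S → (crossing G A).Adj a y ∧ ∀ b : U, (e b : V) = a → y = b := fun a => by
    by_cases ha : ∃ b : U, (e b : V) = a
    · obtain ⟨b, rfl⟩ := ha
      refine ⟨b, fun _ => ⟨?_, fun b' hb' => by rw [e.injective (Subtype.ext hb')]⟩⟩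
      exact (h.adj_of_two_le hG ((memT _).1 (e b).2).1 ((memU _).1 b.2).1 ((memT _).1 (e b).2).2
        ((memU _).1 b.2).2).1
    · by_cases haS : a ∈ S
      · obtain ⟨y, hy⟩ := exists_adj_of_nDeg_pos ((memP a).1 (hSP haS)).2
        exact ⟨y, fun _ => ⟨hy, fun b hb => absurd ⟨b, hb⟩ ha⟩⟩
      · exact ⟨a, fun h => absurd h haS⟩
  choose f hf using hf
  obtain ⟨H, hH, hm0, hm1, hm2, hm3⟩ := exists_subgraph_of_crossing hG (hSP.trans hPA) h.1 f
    (fun a ha => (hf a ha).1) fun b hb => by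
      by_cases hb2 : 2 ≤ nDeg (crossing G A) b
      · have hbU := (memU b).2 ⟨hb, hb2⟩
        have hbT := (memT _).1 (e ⟨b, hbU⟩).2
        refine Or.inr ⟨(h.adj_of_two_le hG hbT.1 hb hbT.2 hb2).2.2, e ⟨b, hbU⟩, ?_, ?_⟩
        · exact hUS (Finset.mem_image_of_mem _ (Finset.mem_univ _))
        · exact (hf _ (hUS (Finset.mem_image_of_mem _ (Finset.mem_univ _)))).2 _ rfl
      · omega
  refine _root_.exists_balanced_or_off_by_one hG hH ?_ ?_ ?_ <;> omega

open Classical in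
theorem exists_balanced_or_off_by_one_of_card (hG : ∀ v, nDeg G v = 3)
    (h6 : 6 ≤ Fintype.card V) (hiso : ¬ Nonempty (G ≃g K33)) :
    ∃ H ≤ G, (∀ k ≤ 3, Fintype.card V ≤ 4 * degCount H k + 2 ∧
        4 * degCount H k ≤ Fintype.card V + 2) ∨
      (degCount H 0 = degCount H 1 + 2 ∧ degCount H 2 = degCount H 1 ∧
        degCount H 3 = degCount H 1 + 2) := by
  have hmain : ∀ A : Finset V, IsMinBisection G A →
      (Aᶜ.filter (fun b => 2 ≤ nDeg (crossing G A) b)).card ≤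
        (A.filter (fun a => 2 ≤ nDeg (crossing G A) a)).card → _ := fun A hA hle => by
    have := hA.1
    refine hA.exists_balanced_or_off_by_one hG (by omega) ?_ hle
    by_cases h3 : A.card = 3
    · exact hA.sum_le_of_card_eq_three hG h3 hiso
    · exact hA.sum_le hG (by omega)
  obtain ⟨A, hA⟩ := exists_isMinBisection hG
  rcases le_total (Aᶜ.filter (fun b => 2 ≤ nDeg (crossing G A) b)).card
    (A.filter (fun a => 2 ≤ nDeg (crossing G A) a)).card with h | h
  · exact hmain A hA h
  · exact hmain Aᶜ hA.compl (by simpa only [crossing_compl, compl_compl] using h)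

theorem card_eq_zero_or_four_or_six_le (hG : ∀ v, nDeg G v = 3) :
    Fintype.card V = 0 ∨ Fintype.card V = 4 ∨ 6 ≤ Fintype.card V := by
  have he := even_card hG
  rw [Nat.even_iff] at he
  rcases isEmpty_or_nonempty V with h | ⟨⟨v⟩⟩
  · exact Or.inl Fintype.card_eq_zero
  · have := Set.ncard_lt_card (s := G.neighborSet v)
      fun h => G.loopless.irrefl v (h ▸ Set.mem_univ v : v ∈ G.neighborSet v)
    have := hG v
    rw [nDeg] at this
    rw [Nat.card_eq_fintype_card] at *
    omega

theorem exists_two_edge_path (hG : ∀ v, nDeg G v = 3) [Nonempty V] :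
    ∃ H ≤ G, degCount H 0 + 3 = Fintype.card V ∧ degCount H 1 = 2 ∧ degCount H 2 = 1 ∧
      degCount H 3 = 0 := by
  obtain ⟨v⟩ := ‹Nonempty V›
  obtain ⟨x, hx⟩ := exists_adj_of_nDeg_pos (H := G) (v := v) (by rw [hG]; norm_num)
  obtain ⟨y, hy, hyx⟩ := exists_adj_ne_of_one_lt_nDeg (H := G) (v := v) (by rw [hG]; norm_num) x
  have h0 : ∀ w, nDeg (⊥ : SimpleGraph V) w = 0 := fun w => by simp [nDeg]
  have hc : ∀ k, degCount (⊥ : SimpleGraph V) k = if k = 0 then Fintype.card V else 0 := fun k => by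
    split_ifs with hk
    · simp [degCount, h0, hk, Set.ncard_univ]
    · simp [degCount, h0, Ne.symm hk]
  obtain ⟨H₁, hH₁, hd, hv, -, hadj, hk⟩ := exists_add_edge bot_le hx (by simp) (h0 v) (h0 x)
  have hne := hx.ne
  have hne' := hy.ne
  obtain ⟨H₂, hH₂, -, -, -, -, hk'⟩ := exists_add_edge hH₁ hy (by
    rcases hadj v y with h | h | h
    · exact absurd h.2 hyx
    · exact absurd h.1 hne
    · rw [h]
      simp) hv (show nDeg H₁ y = 0 by
    rcases hd y with h | h | h
    · exact absurd h.symm hne'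
    · exact absurd h hyx
    · rw [h, h0])
  refine ⟨H₂, hH₂, ?_, ?_, ?_, ?_⟩
  · have := hk 0
    have := hk' 0
    simp [hc] at *
    omega
  · have := hk 1
    have := hk' 1
    simp [hc] at *
    omega
  · have := hk 2
    have := hk' 2
    simp [hc] at *
    omega
  · have := hk 3
    have := hk' 3
    simp [hc] at *
    omega

theorem abs_sub_div_four_le {m n d : ℕ} (h1 : n ≤ 4 * m + d) (h2 : 4 * m ≤ n + d) :
    |(m : ℚ) - (n : ℚ) / 4| ≤ (d : ℚ) / 4 := by
  have h1' : (n : ℚ) ≤ 4 * m + d := by exact_mod_cast h1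
  have h2' : (4 * m : ℚ) ≤ n + d := by exact_mod_cast h2
  rw [abs_le]
  constructor <;> linarith

/-- Every cubic graph not isomorphic to one of the three exceptions has a subgraph in which the
four degrees occur almost equally often. -/
theorem exists_balanced (hG : ∀ v, nDeg G v = 3) (h4 : ¬ Nonempty (G ≃g K4))
    (h12 : ¬ Nonempty (G ≃g unionK4 3)) (h33 : ¬ Nonempty (G ≃g K33)) :
    ∃ H ≤ G, ∀ k ≤ 3, Fintype.card V ≤ 4 * degCount H k + 2 ∧
      4 * degCount H k ≤ Fintype.card V + 2 := by
  rcases card_eq_zero_or_four_or_six_le hG with h | h | h6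
  · have := sum_degCount hG (bot_le : ⊥ ≤ G)
    refine ⟨⊥, bot_le, fun k hk => ?_⟩
    interval_cases k <;> omega
  · exact absurd (nonempty_iso_K4 hG h) h4
  · obtain ⟨H, hH, h | ⟨e0, e2, e3⟩⟩ := exists_balanced_or_off_by_one_of_card hG h6 h33
    · exact ⟨H, hH, h⟩
    · have hs := sum_degCount hG hH
      obtain ⟨H', hH', h0, h1, h2, h3⟩ := shiftsInward_of_off_by_one hG hH e0 e2 e3 (by omega) h12
      refine ⟨H', hH', fun k hk => ?_⟩
      interval_cases k <;> omega

theorem exists_nearly_balanced (hG : ∀ v, nDeg G v = 3) :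
    ∃ H ≤ G, ∀ k ≤ 3, Fintype.card V ≤ 4 * degCount H k + 6 ∧
      4 * degCount H k ≤ Fintype.card V + 6 := by
  by_cases h : 6 < Fintype.card V
  · obtain ⟨H, hH, h' | h'⟩ := exists_balanced_or_off_by_one_of_card hG h.le fun ⟨e⟩ => by
      have := e.card_eq
      simp at this
      omega
    · refine ⟨H, hH, fun k hk => ?_⟩
      have := h' k hk
      omega
    · have := sum_degCount hG hH
      refine ⟨H, hH, fun k hk => ?_⟩
      interval_cases k <;> omega
  · rcases isEmpty_or_nonempty V with hV | hV
    · have := sum_degCount hG (bot_le : ⊥ ≤ G)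
      rw [Fintype.card_eq_zero] at *
      refine ⟨⊥, bot_le, fun k hk => ?_⟩
      interval_cases k <;> omega
    · obtain ⟨H, hH, h0, h1, h2, h3⟩ := exists_two_edge_path hG
      refine ⟨H, hH, fun k hk => ?_⟩
      interval_cases k <;> omega

end Assembly

theorem stmt18 {V : Type*} [Fintype V] (G : SimpleGraph V)
    (hcubic : ∀ v, nDeg G v = 3) :
    (∃ H ≤ G, ∀ k ≤ 3,
      |(degCount H k : ℚ) - (Fintype.card V : ℚ) / 4| ≤ 3 / 2) ∧
    ((¬ Nonempty (G ≃g K4) → ¬ Nonempty (G ≃g unionK4 3) → ¬ Nonempty (G ≃g K33) →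
      ∃ H ≤ G, ∀ k ≤ 3,
        |(degCount H k : ℚ) - (Fintype.card V : ℚ) / 4| ≤ 1 / 2)) := by
  constructor
  · obtain ⟨H, hH, h⟩ := exists_nearly_balanced hcubic
    refine ⟨H, hH, fun k hk => (abs_sub_div_four_le (h k hk).1 (h k hk).2).trans_eq ?_⟩
    norm_num
  · intro h4 h12 h33
    obtain ⟨H, hH, h⟩ := exists_balanced hcubic h4 h12 h33
    refine ⟨H, hH, fun k hk => (abs_sub_div_four_le (h k hk).1 (h k hk).2).trans_eq ?_⟩
    norm_num
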